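/- arXiv:2304.08626 — 14 statements merged into one kernel-verified Lean document; each statement's English description precedes it below -/
import Mathlib

section
/- Let D ⊂ ℝⁿ be a compact set with 0 < μ(D) < ∞ for a Borel measure μ, let ‖·‖₀ be a norm on ℝⁿ with induced distance d, and let u : ℝ → ℝ be a strictly monotone increasing convex function with u(0) = 0. Then every sublevel set C_D = { x ∈ ℝⁿ : f_D(x) ≤ c } of the distance mean function f_D is convex and compact. -/
open MeasureTheory
open scoped ENNReal

/-- Let `D ⊆ ℝⁿ` be compact with `0 < μ D < ∞` for a Borel measure `μ`,
let `N` be a norm on `ℝⁿ` inducing the distance `d(x,y) = N (x - y)`, and let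
`u : ℝ → ℝ` be a strictly monotone increasing convex function with `u 0 = 0`.
Then every sublevel set of the distance mean function
`f_D x = (1 / μ D) ∫_D u (d x y) dμ y` is convex and compact. -/
theorem sublevel_sets_of_distance_mean_function_convex_compact
    (n : ℕ) (μ : Measure (Fin n → ℝ))
    (N : (Fin n → ℝ) → ℝ)
    (hN_add : ∀ x y, N (x + y) ≤ N x + N y)
    (hN_smul : ∀ (a : ℝ) (x), N (a • x) = |a| * N x)
    (hN_zero : ∀ x, N x = 0 → x = 0)
    (u : ℝ → ℝ) (hu_mono : StrictMono u)
    (hu_conv : ConvexOn ℝ Set.univ u) (hu0 : u 0 = 0)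
    (D : Set (Fin n → ℝ)) (hD : IsCompact D)
    (hD0 : 0 < μ D) (hDfin : μ D < ∞)
    (f : (Fin n → ℝ) → ℝ)
    (hf : ∀ x, f x = (μ D).toReal⁻¹ * ∫ y in D, u (N (x - y)) ∂μ)
    (c : ℝ) :
    Convex ℝ {x | f x ≤ c} ∧ IsCompact {x | f x ≤ c} := by
  have hN0 : N 0 = 0 := by simpa using hN_smul 0 0
  have hNneg : ∀ x, N (-x) = N x := fun x => by simpa using hN_smul (-1) x
  have hNnn : ∀ x, 0 ≤ N x := fun x => by
    have h := hN_add x (-x)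
    rw [add_neg_cancel, hN0, hNneg] at h
    linarith
  have hNconv : ConvexOn ℝ Set.univ N := by
    refine ⟨convex_univ, fun x _ y _ a b ha hb _ => ?_⟩
    have h := hN_add (a • x) (b • y)
    rw [hN_smul, hN_smul, abs_of_nonneg ha, abs_of_nonneg hb] at h
    simpa using h
  have hNcont : Continuous N :=
    continuousOn_univ.1 (hNconv.continuousOn isOpen_univ)
  have hucont : Continuous u :=
    continuousOn_univ.1 (hu_conv.continuousOn isOpen_univ)
  have hDm : MeasurableSet D := hD.isClosed.measurableSet
  have hint : ∀ x, IntegrableOn (fun y => u (N (x - y))) D μ := fun x => by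
    have hc : Continuous (fun y => u (N (x - y))) := by fun_prop
    exact hc.continuousOn.integrableOn_of_subset_isCompact hD hDm subset_rfl hDfin.ne
  have hpos : 0 < (μ D).toReal := ENNReal.toReal_pos hD0.ne' hDfin.ne
  have hfconv : ConvexOn ℝ Set.univ f := by
    refine ⟨convex_univ, fun x _ z _ a b ha hb hab => ?_⟩
    simp only [hf, smul_eq_mul]
    have key : ∫ y in D, u (N (a • x + b • z - y)) ∂μ ≤
        ∫ y in D, (a * u (N (x - y)) + b * u (N (z - y))) ∂μ := by
      refine setIntegral_mono_on (hint _) (((hint x).const_mul a).add ((hint z).const_mul b)) hDm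
        fun y _ => ?_
      have e : a • x + b • z - y = a • (x - y) + b • (z - y) := by
        have : y = a • y + b • y := by rw [← add_smul, hab, one_smul]
        rw [smul_sub, smul_sub]
        nth_rewrite 1 [this]
        abel
      rw [e]
      calc u (N (a • (x - y) + b • (z - y)))
          ≤ u (a * N (x - y) + b * N (z - y)) := hu_mono.monotone (by
            simpa using hNconv.2 (Set.mem_univ (x - y)) (Set.mem_univ (z - y)) ha hb hab)
        _ ≤ _ := by
            simpa using hu_conv.2 (Set.mem_univ (N (x - y))) (Set.mem_univ (N (z - y))) ha hb hab
    rw [integral_add ((hint x).const_mul a) ((hint z).const_mul b), integral_const_mul,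
      integral_const_mul] at key
    calc _ ≤ _ := mul_le_mul_of_nonneg_left key (inv_nonneg.2 hpos.le)
      _ = _ := by ring
  have hfcont : Continuous f :=
    continuousOn_univ.1 (hfconv.continuousOn isOpen_univ)
  refine ⟨by simpa using hfconv.convex_le c, ?_⟩
  obtain ⟨R, hR⟩ := hD.bddAbove_image hNcont.continuousOn
  have hlow : ∀ x, u (N x - R) ≤ f x := fun x => by
    have h1 : ∫ y in D, u (N x - R) ∂μ ≤ ∫ y in D, u (N (x - y)) ∂μ := by
      refine setIntegral_mono_on (integrableOn_const hDfin.ne) (hint x) hDm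
        fun y hy => hu_mono.monotone ?_
      have h2 := hN_add (x - y) y
      rw [sub_add_cancel] at h2
      have h3 := hR (Set.mem_image_of_mem N hy)
      linarith
    rw [setIntegral_const, smul_eq_mul, Measure.real] at h1
    rw [hf, inv_mul_eq_div, le_div_iff₀ hpos]
    linarith
  have hu1 : 0 < u 1 := hu0 ▸ hu_mono one_pos
  have hulin : ∀ t, 1 ≤ t → t * u 1 ≤ u t := fun t ht => by
    have ht0 : 0 < t := by linarith
    have h := hu_conv.2 (Set.mem_univ t) (Set.mem_univ 0) (inv_nonneg.2 ht0.le)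
      (sub_nonneg.2 (inv_le_one_of_one_le₀ ht)) (by ring)
    simp only [smul_eq_mul, mul_zero, add_zero, hu0, inv_mul_cancel₀ ht0.ne'] at h
    rw [inv_mul_eq_div, le_div_iff₀ ht0] at h
    linarith
  have hNb : ∀ x, f x ≤ c → N x ≤ R + max 1 (c / u 1) := fun x hx => by
    by_contra! h
    have ha := le_max_left 1 (c / u 1)
    have hb := le_max_right 1 (c / u 1)
    have h1 := hulin (N x - R) (by linarith)
    have h2 : c / u 1 < N x - R := by linarith
    rw [div_lt_iff₀ hu1] at h2
    linarith [hlow x]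
  obtain ⟨m, hm, hmN⟩ := (isCompact_sphere (0 : Fin n → ℝ) 1).exists_forall_le' (a := 0)
    hNcont.continuousOn (fun z hz => by
      refine lt_of_le_of_ne (hNnn z) fun h => ?_
      have := hN_zero z h.symm
      subst this
      simp at hz)
  have hbd : ∀ x, m * ‖x‖ ≤ N x := fun x => by
    by_cases hx : x = 0
    · simp [hx, hN0]
    have hx' : 0 < ‖x‖ := norm_pos_iff.2 hx
    have h := hmN (‖x‖⁻¹ • x) (by simp [norm_smul, hx'.ne'])
    rw [hN_smul, abs_of_pos (inv_pos.2 hx'), inv_mul_eq_div, le_div_iff₀ hx'] at h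
    exact h
  refine Metric.isCompact_of_isClosed_isBounded (isClosed_le hfcont continuous_const) ?_
  refine (Metric.isBounded_closedBall (x := (0 : Fin n → ℝ))
    (r := (R + max 1 (c / u 1)) / m)).subset fun x hx => ?_
  rw [mem_closedBall_zero_iff, le_div_iff₀ hm]
  linarith [hbd x, hNb x hx]
end

section
/- Let D ⊂ ℝⁿ be a compact set with 0 < μ(D) < ∞ for a Borel measure μ and let d be the distance induced by a norm on ℝⁿ. Let f_D(x) = (1/μ(D)) ∫_D d(x,y) dμ(y) and let C_D = { x : f_D(x) ≤ c } be a sublevel set of f_D with 0 < μ(C_D) < ∞. If C* ⊂ ℝⁿ is a compact set with μ(C_D) = μ(C*) and f_{C*}(x) = f_{C_D}(x) for all x ∈ ℝⁿ, then μ(C_D △ C*) = 0, i.e. C_D equals C* except on a set of μ-measure zero. -/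
open MeasureTheory
open scoped ENNReal symmDiff

/-- Let `D ⊆ ℝⁿ` be compact with `0 < μ D < ∞` for a Borel measure `μ`,
and let `d(x,y) = N (x - y)` be the distance induced by a norm `N` on `ℝⁿ`. Let
`f_D x = (1 / μ D) ∫_D d x y dμ y` and let `C = {x | f_D x ≤ c}` be a sublevel set of
`f_D` with `0 < μ C < ∞`. If `C*` is a compact set with `μ C = μ C*` whose distance
mean function coincides with that of `C` everywhere, then `μ (C ∆ C*) = 0`. -/
theorem sublevel_set_unique_up_to_measure_zero
    (n : ℕ) (μ : Measure (Fin n → ℝ))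
    (N : (Fin n → ℝ) → ℝ)
    (hN_add : ∀ x y, N (x + y) ≤ N x + N y)
    (hN_smul : ∀ (a : ℝ) (x), N (a • x) = |a| * N x)
    (hN_zero : ∀ x, N x = 0 → x = 0)
    (D : Set (Fin n → ℝ)) (hD : IsCompact D)
    (hD0 : 0 < μ D) (hDfin : μ D < ∞)
    (c : ℝ) (C : Set (Fin n → ℝ))
    (hC : C = {x | (μ D).toReal⁻¹ * ∫ y in D, N (x - y) ∂μ ≤ c})
    (hC0 : 0 < μ C) (hCfin : μ C < ∞)
    (Cstar : Set (Fin n → ℝ)) (hCstar : IsCompact Cstar)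
    (hmeas : μ C = μ Cstar)
    (heq : ∀ x, (μ Cstar).toReal⁻¹ * ∫ y in Cstar, N (x - y) ∂μ =
      (μ C).toReal⁻¹ * ∫ y in C, N (x - y) ∂μ) :
    μ (C ∆ Cstar) = 0 := by
  have hN0 : N 0 = 0 := by simpa using hN_smul 0 0
  have hNneg : ∀ x, N (-x) = N x := fun x => by simpa using hN_smul (-1) x
  have hNsymm : ∀ x y, N (x - y) = N (y - x) := fun x y => by
    rw [← hNneg, neg_sub]
  have hNnn : ∀ x, 0 ≤ N x := fun x => by
    have := hN_add x (-x)
    rw [hNneg, add_neg_cancel, hN0] at this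
    linarith
  have hNcont : Continuous N := by
    have hconv : ConvexOn ℝ Set.univ N := by
      refine ⟨convex_univ, fun x _ y _ a b ha hb _ => ?_⟩
      have := hN_add (a • x) (b • y)
      rw [hN_smul, hN_smul, abs_of_nonneg ha, abs_of_nonneg hb] at this
      simpa using this
    exact continuousOn_univ.1 (hconv.continuousOn isOpen_univ)
  have hFcont : Continuous (Function.uncurry fun x y : Fin n → ℝ => N (x - y)) := by
    unfold Function.uncurry
    fun_prop
  haveI : IsFiniteMeasure (μ.restrict D) := ⟨by simpa using hDfin⟩
  haveI : IsFiniteMeasure (μ.restrict C) := ⟨by simpa using hCfin⟩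
  have hSfin : μ Cstar < ∞ := hmeas ▸ hCfin
  haveI : IsFiniteMeasure (μ.restrict Cstar) := ⟨by simpa using hSfin⟩
  set g : (Fin n → ℝ) → ℝ := fun x => ∫ y in D, N (x - y) ∂μ with hg
  have hgcont : Continuous g := by
    have := continuous_parametric_integral_of_continuous (μ := μ.restrict D) hFcont hD
    rwa [Measure.restrict_restrict hD.measurableSet, Set.inter_self] at this
  have hgnn : ∀ x, 0 ≤ g x := fun x => integral_nonneg fun y => hNnn _
  have hDpos : 0 < (μ D).toReal := ENNReal.toReal_pos hD0.ne' hDfin.ne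
  have hCpos : 0 < (μ C).toReal := ENNReal.toReal_pos hC0.ne' hCfin.ne
  set k := c * (μ D).toReal with hk
  have hC' : C = {x | g x ≤ k} := by
    rw [hC]
    ext x
    simp only [Set.mem_setOf_eq]
    rw [inv_mul_le_iff₀ hDpos, mul_comm]
  have hCm : MeasurableSet C := by
    rw [hC']
    exact (isClosed_le hgcont continuous_const).measurableSet
  have hSm : MeasurableSet Cstar := hCstar.measurableSet
  have heq' : ∀ x, ∫ y in Cstar, N (x - y) ∂μ = ∫ y in C, N (x - y) ∂μ := fun x => by
    have := heq x
    rw [← hmeas] at this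
    exact mul_left_cancel₀ (inv_pos.2 hCpos).ne' this
  have hgC : IntegrableOn g C μ := by
    refine Integrable.of_bound (C := k) hgcont.aestronglyMeasurable ?_
    filter_upwards [ae_restrict_mem hCm] with x hx
    rw [Real.norm_of_nonneg (hgnn x)]
    rw [hC'] at hx
    exact hx
  have hgS : IntegrableOn g Cstar μ := by
    obtain ⟨M, hM⟩ := hCstar.exists_bound_of_continuousOn hgcont.continuousOn
    refine Integrable.of_bound (C := M) hgcont.aestronglyMeasurable ?_
    filter_upwards [ae_restrict_mem hSm] with x hx
    exact hM x hx
  have hNint : ∀ x, IntegrableOn (fun y => N (x - y)) D μ := fun x => by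
    have hc : Continuous fun y => N (x - y) := by fun_prop
    obtain ⟨M, hM⟩ := hD.exists_bound_of_continuousOn hc.continuousOn
    refine Integrable.of_bound (C := M) hc.aestronglyMeasurable ?_
    filter_upwards [ae_restrict_mem hD.measurableSet] with y hy
    exact hM y hy
  have key : ∀ A : Set (Fin n → ℝ), IsFiniteMeasure (μ.restrict A) → IntegrableOn g A μ →
      ∫ x in A, g x ∂μ = ∫ y in D, ∫ x in A, N (y - x) ∂μ ∂μ := by
    intro A _ hA
    have hint : Integrable (Function.uncurry fun x y : Fin n → ℝ => N (x - y))
        ((μ.restrict A).prod (μ.restrict D)) := by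
      rw [integrable_prod_iff hFcont.aestronglyMeasurable]
      refine ⟨Filter.Eventually.of_forall fun x => hNint x, ?_⟩
      refine hA.congr (Filter.Eventually.of_forall fun x => ?_)
      simp only [hg, Function.uncurry]
      exact integral_congr_ae (Filter.Eventually.of_forall fun y =>
        (Real.norm_of_nonneg (hNnn _)).symm)
    simp only [hg]
    rw [integral_integral_swap hint]
    congr 1
    ext y
    congr 1
    ext x
    exact hNsymm _ _
  have hmain : ∫ x in C, g x ∂μ = ∫ x in Cstar, g x ∂μ := by
    rw [key C inferInstance hgC, key Cstar inferInstance hgS]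
    simp only [heq']
  have hmain2 : ∫ x in C, (g x - k) ∂μ = ∫ x in Cstar, (g x - k) ∂μ := by
    rw [integral_sub hgC (integrable_const k), integral_sub hgS (integrable_const k), hmain]
    simp [Measure.real, hmeas]
  have hiC : IntegrableOn (fun x => g x - k) C μ := Integrable.sub hgC (integrable_const k)
  have hiS : IntegrableOn (fun x => g x - k) Cstar μ := Integrable.sub hgS (integrable_const k)
  have e1 := integral_inter_add_diff hSm hiC
  have e2 := integral_inter_add_diff hCm hiS
  rw [Set.inter_comm] at e2
  have l1 : ∫ x in C \ Cstar, (g x - k) ∂μ ≤ 0 := by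
    refine setIntegral_nonpos (hCm.diff hSm) fun x hx => ?_
    have := hx.1
    rw [hC'] at this
    exact sub_nonpos.2 this
  have hposS : ∀ x ∈ Cstar \ C, 0 < g x - k := fun x hx => by
    have := hx.2
    rw [hC'] at this
    exact sub_pos.2 (not_le.1 this)
  have hz : μ (Cstar \ C) = 0 := by
    by_contra hne
    have hp : 0 < ∫ x in Cstar \ C, (g x - k) ∂μ := by
      rw [setIntegral_pos_iff_support_of_nonneg_ae]
      · refine lt_of_lt_of_le (pos_iff_ne_zero.2 hne) (measure_mono fun x hx => ⟨(hposS x hx).ne', hx⟩)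
      · filter_upwards [ae_restrict_mem (hSm.diff hCm)] with x hx
        exact (hposS x hx).le
      · exact hiS.mono_set Set.diff_subset
    linarith
  have hz2 : μ (C \ Cstar) = 0 := by
    have a1 := measure_inter_add_diff (μ := μ) C hSm
    have a2 := measure_inter_add_diff (μ := μ) Cstar hCm
    rw [hz, add_zero, Set.inter_comm] at a2
    rw [a2, hmeas] at a1
    have : μ Cstar + μ (C \ Cstar) = μ Cstar + 0 := by rw [a1, add_zero]
    exact (ENNReal.add_right_inj hSfin.ne).1 this
  rw [Set.symmDiff_def]
  exact measure_union_null hz2 hz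
end

section
/- Let K ⊂ ℝⁿ be a compact set and f_K(x) = ∫_K d₁(x,y) dy its taxicab distance mean function. Then for every x ∈ ℝⁿ and every i ∈ {1,…,n}, the partial derivative of f_K at x in the i-th coordinate direction exists and equals D_i f_K(x) = μ_n(K ∩ { y : yⁱ ≤ xⁱ }) − μ_n(K ∩ { y : xⁱ ≤ yⁱ }), where μ_n is n-dimensional Lebesgue measure. -/
open MeasureTheory
open scoped ENNReal

/-- Let `K ⊆ ℝⁿ` be compact and let
`f_K x = ∫_K d₁ x y dy` be its taxicab distance mean function, where
`d₁ x y = ∑ i, |x i - y i|`. Then for every `x` and every coordinate `i`,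
the `i`-th partial derivative of `f_K` at `x` exists and equals
`μₙ (K ∩ {y | y i ≤ x i}) - μₙ (K ∩ {y | x i ≤ y i})`. -/
theorem partial_derivative_of_taxicab_distance_mean_function
    (n : ℕ) (K : Set (Fin n → ℝ)) (hK : IsCompact K)
    (f : (Fin n → ℝ) → ℝ)
    (hf : ∀ x, f x = ∫ y in K, ∑ i, |x i - y i|)
    (x : Fin n → ℝ) (i : Fin n) :
    HasDerivAt (fun t : ℝ => f (Function.update x i t))
      ((volume (K ∩ {y | y i ≤ x i})).toReal - (volume (K ∩ {y | x i ≤ y i})).toReal)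
      (x i) := by
  have hsum : ∀ (t : ℝ) (y : Fin n → ℝ), ∑ j, |Function.update x i t j - y j|
      = |t - y i| + ∑ j ∈ Finset.univ.erase i, |x j - y j| := by
    intro t y
    rw [← Finset.add_sum_erase _ _ (Finset.mem_univ i)]
    congr 1
    · simp
    · refine Finset.sum_congr rfl fun j hj => ?_
      rw [Function.update_of_ne (Finset.ne_of_mem_erase hj)]
  simp only [hf, hsum]
  have hA : MeasurableSet {y : Fin n → ℝ | y i ≤ x i} :=
    measurableSet_le (measurable_pi_apply i) measurable_const
  have hB : MeasurableSet {y : Fin n → ℝ | x i ≤ y i} :=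
    measurableSet_le measurable_const (measurable_pi_apply i)
  haveI : IsFiniteMeasure (volume.restrict K) :=
    ⟨by rw [Measure.restrict_apply_univ]; exact hK.measure_lt_top⟩
  have hIA : Integrable ({y : Fin n → ℝ | y i ≤ x i}.indicator (fun _ => (1 : ℝ)))
      (volume.restrict K) := (integrable_const 1).indicator hA
  have hIB : Integrable ({y : Fin n → ℝ | x i ≤ y i}.indicator (fun _ => (1 : ℝ)))
      (volume.restrict K) := (integrable_const 1).indicator hB
  have hcont : ∀ t : ℝ, Continuous (fun y : Fin n → ℝ =>
      |t - y i| + ∑ j ∈ Finset.univ.erase i, |x j - y j|) := by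
    intro t; fun_prop
  have hne : ∀ᵐ y ∂(volume.restrict K), y i ≠ x i := by
    refine ae_restrict_of_ae ?_
    exact Measure.pi_hyperplane (fun _ : Fin n => (volume : Measure ℝ)) i (x i) |> fun h => by
      rw [ae_iff]; simpa [volume_pi] using h
  have key := (hasDerivAt_integral_of_dominated_loc_of_lip
    (μ := volume.restrict K) (s := Set.univ) (x₀ := x i) (bound := fun _ => (1 : ℝ))
    (F := fun (t : ℝ) (y : Fin n → ℝ) => |t - y i| + ∑ j ∈ Finset.univ.erase i, |x j - y j|)
    (F' := fun y => {y : Fin n → ℝ | y i ≤ x i}.indicator (fun _ => (1 : ℝ)) y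
      - {y : Fin n → ℝ | x i ≤ y i}.indicator (fun _ => (1 : ℝ)) y)
    Filter.univ_mem
    (Filter.Eventually.of_forall fun t => (hcont t).aestronglyMeasurable)
    ((hcont (x i)).continuousOn.integrableOn_compact hK)
    (hIA.sub hIB).aestronglyMeasurable ?_ (integrable_const 1) ?_).2
  · rw [integral_sub hIA hIB, integral_indicator_const _ hA, integral_indicator_const _ hB] at key
    simpa [measureReal_def, Measure.restrict_apply hA, Measure.restrict_apply hB,
      Set.inter_comm] using key
  · refine Filter.Eventually.of_forall fun y => ?_
    refine LipschitzOnWith.of_dist_le_mul fun a _ b _ => ?_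
    simp only [Real.dist_eq, add_sub_add_right_eq_sub]
    have := abs_abs_sub_abs_le_abs_sub (a - y i) (b - y i)
    simpa using this
  · filter_upwards [hne] with y hy
    have h1 : HasDerivAt (fun t : ℝ => t - y i) 1 (x i) := (hasDerivAt_id _).sub_const _
    refine HasDerivAt.add_const _ ?_
    rcases lt_or_gt_of_ne hy with h | h
    · have := (hasDerivAt_abs_pos (sub_pos.2 h)).comp (x i) h1
      simpa [Set.indicator, h.le, not_le.2 h, Function.comp_def] using this
    · have := (hasDerivAt_abs_neg (sub_neg.2 h)).comp (x i) h1
      simpa [Set.indicator, h.le, not_le.2 h, Function.comp_def] using this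
end

section
/- Let K ⊂ ℝⁿ be a compact set of finite positive Lebesgue measure and f_K(x) = ∫_K d₁(x,y) dy its taxicab distance mean function. A point x ∈ ℝⁿ is a global minimizer of f_K if and only if for every i ∈ {1,…,n} we have μ_n(K ∩ { y : yⁱ < xⁱ }) = μ_n(K ∩ { y : yⁱ > xⁱ }), i.e. each coordinate hyperplane through x divides K into two parts of equal Lebesgue measure. -/
open MeasureTheory
open scoped ENNReal

lemma aux_sign_integral {α : Type*} [MeasurableSpace α] (ν : Measure α) [IsFiniteMeasure ν]
    (h : α → ℝ) (hm : Measurable h) (a : ℝ) :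
    Integrable (fun y => Set.indicator {y | h y < a} (fun _ => (1:ℝ)) y
      - Set.indicator {y | a < h y} (fun _ => (1:ℝ)) y) ν ∧
    ∫ y, (Set.indicator {y | h y < a} (fun _ => (1:ℝ)) y
      - Set.indicator {y | a < h y} (fun _ => (1:ℝ)) y) ∂ν
      = ν.real {y | h y < a} - ν.real {y | a < h y} := by
  have m1 : MeasurableSet {y | h y < a} := measurableSet_lt hm measurable_const
  have m2 : MeasurableSet {y | a < h y} := measurableSet_lt measurable_const hm
  have i1 : Integrable (Set.indicator {y | h y < a} (fun _ => (1:ℝ))) ν :=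
    (integrable_const (1:ℝ)).indicator m1
  have i2 : Integrable (Set.indicator {y | a < h y} (fun _ => (1:ℝ))) ν :=
    (integrable_const (1:ℝ)).indicator m2
  refine ⟨i1.sub i2, ?_⟩
  rw [integral_sub i1 i2, integral_indicator_const _ m1, integral_indicator_const _ m2]
  simp

lemma aux_one_dim {α : Type*} [MeasurableSpace α] (ν : Measure α) [IsFiniteMeasure ν]
    (h : α → ℝ) (hm : Measurable h) (hi : Integrable h ν) (a : ℝ) (h0 : ν {y | h y = a} = 0) :
    (∀ t, ∫ y, |a - h y| ∂ν ≤ ∫ y, |t - h y| ∂ν) ↔ ν {y | h y < a} = ν {y | a < h y} := by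
  have hint : ∀ t : ℝ, Integrable (fun y => |t - h y|) ν :=
    fun t => ((integrable_const t).sub hi).abs
  obtain ⟨is, es⟩ := aux_sign_integral ν h hm a
  have key : ν {y | h y < a} = ν {y | a < h y} ↔
      ν.real {y | h y < a} - ν.real {y | a < h y} = 0 := by
    rw [sub_eq_zero, measureReal_def, measureReal_def,
      ENNReal.toReal_eq_toReal_iff' (measure_ne_top _ _) (measure_ne_top _ _)]
  rw [key, ← es]
  have hne : ∀ᵐ y ∂ν, h y ≠ a := by
    rw [ae_iff]; simpa using h0
  constructor
  · intro hmin
    have hd := hasDerivAt_integral_of_dominated_loc_of_lip (μ := ν) (x₀ := a)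
      (F := fun t y => |t - h y|)
      (F' := fun y => (Set.indicator {y | h y < a} (fun _ => (1:ℝ)) y
        - Set.indicator {y | a < h y} (fun _ => (1:ℝ)) y))
      (bound := fun _ => 1) (s := Set.univ) Filter.univ_mem
      (Filter.Eventually.of_forall fun t => (hint t).aestronglyMeasurable)
      (hint a) is.aestronglyMeasurable
      (Filter.Eventually.of_forall fun y => by
        refine LipschitzOnWith.of_dist_le_mul fun s _ t _ => ?_
        simp only [Real.dist_eq, map_one, NNReal.coe_one, one_mul]
        refine (abs_abs_sub_abs_le _ _).trans (le_of_eq (by congr 1; ring)))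
      (integrable_const _) (by
        filter_upwards [hne] with y hy
        rcases lt_or_gt_of_ne hy with h1 | h1
        · have h2 : ¬ a < h y := not_lt.2 h1.le
          simp only [Set.indicator, Set.mem_ofPred_eq, h1, h2, if_true, if_false, sub_zero]
          have : HasDerivAt (fun t : ℝ => t - h y) 1 a := (hasDerivAt_id a).sub_const _
          refine this.congr_of_eventuallyEq ?_
          filter_upwards [lt_mem_nhds h1] with t ht
          exact abs_of_pos (sub_pos.2 ht)
        · have h1 : a < h y := h1
          have h2 : ¬ h y < a := not_lt.2 h1.le
          simp only [Set.indicator, Set.mem_ofPred_eq, h1, h2, if_true, if_false, zero_sub]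
          have : HasDerivAt (fun t : ℝ => h y - t) (-1) a := (hasDerivAt_id a).const_sub _
          refine this.congr_of_eventuallyEq ?_
          filter_upwards [gt_mem_nhds h1] with t ht
          rw [abs_of_neg (sub_neg.2 ht)]; ring)
    have hl : IsLocalMin (fun t => ∫ y, |t - h y| ∂ν) a := Filter.Eventually.of_forall hmin
    exact hl.hasDerivAt_eq_zero hd.2
  · intro hz t
    have : ∫ y, (t - a) * (Set.indicator {y | h y < a} (fun _ => (1:ℝ)) y
      - Set.indicator {y | a < h y} (fun _ => (1:ℝ)) y) ∂ν ≤ ∫ y, (|t - h y| - |a - h y|) ∂ν := by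
      refine integral_mono (is.const_mul _) ((hint t).sub (hint a)) fun y => ?_
      simp only [Set.indicator, Set.mem_ofPred_eq]
      have e1 := le_abs_self (t - h y)
      have e2 := neg_abs_le (t - h y)
      rcases lt_trichotomy (h y) a with h1 | h1 | h1
      · rw [if_pos h1, if_neg (not_lt.2 h1.le), abs_of_pos (sub_pos.2 h1)]; linarith
      · simp [h1]
      · rw [if_pos h1, if_neg (not_lt.2 h1.le), abs_of_neg (sub_neg.2 h1)]; linarith
    rw [integral_const_mul, hz, mul_zero, integral_sub (hint t) (hint a)] at this
    linarith

/-- Let `K ⊆ ℝⁿ` be a compact set of finite positive Lebesgue measure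
and let `f_K x = ∫_K d₁ x y dy` be its taxicab distance mean function, where
`d₁ x y = ∑ i, |x i - y i|`. A point `x` is a global minimizer of `f_K` if and only if
each coordinate hyperplane through `x` divides `K` into two parts of equal measure. -/
theorem minimizer_of_taxicab_distance_mean_function_iff_bisection
    (n : ℕ) (K : Set (Fin n → ℝ)) (hK : IsCompact K)
    (hK0 : 0 < volume K) (hKfin : volume K < ∞)
    (f : (Fin n → ℝ) → ℝ)
    (hf : ∀ x, f x = ∫ y in K, ∑ i, |x i - y i|)
    (x : Fin n → ℝ) :
    (∀ z, f x ≤ f z) ↔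
      ∀ i, volume (K ∩ {y | y i < x i}) = volume (K ∩ {y | x i < y i}) := by
  have : IsFiniteMeasure (volume.restrict K) := isFiniteMeasure_restrict.2 hKfin.ne
  have hi : ∀ i, Integrable (fun y : Fin n → ℝ => y i) (volume.restrict K) := fun i =>
    (continuous_apply i).continuousOn.integrableOn_compact hK
  have h0 : ∀ i, (volume.restrict K) {y : Fin n → ℝ | y i = x i} = 0 := fun i => by
    refine le_antisymm ((Measure.restrict_apply_le _ _).trans (le_of_eq ?_)) zero_le
    exact Measure.pi_hyperplane (fun _ : Fin n => (volume : Measure ℝ)) i (x i)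
  have hone := fun i => aux_one_dim (volume.restrict K) (fun y : Fin n → ℝ => y i)
    (measurable_pi_apply i) (hi i) (x i) (h0 i)
  have hfs : ∀ z, f z = ∑ i, ∫ y in K, |z i - y i| := fun z => by
    rw [hf, integral_finsetSum]
    exact fun i _ => ((integrable_const _).sub (hi i)).abs
  have hR : ∀ i, ((volume.restrict K) {y | y i < x i} = (volume.restrict K) {y | x i < y i}) ↔
      volume (K ∩ {y | y i < x i}) = volume (K ∩ {y | x i < y i}) := fun i => by
    rw [Measure.restrict_apply (measurableSet_lt (measurable_pi_apply i) measurable_const),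
      Measure.restrict_apply (measurableSet_lt measurable_const (measurable_pi_apply i)),
      Set.inter_comm, Set.inter_comm _ K]
  constructor
  · intro hmin i
    refine (hR i).1 ((hone i).1 fun t => ?_)
    have := hmin (Function.update x i t)
    rw [hfs, hfs, ← Finset.add_sum_erase _ _ (Finset.mem_univ i),
      ← Finset.add_sum_erase (a := i) _ (fun j => ∫ y in K, |Function.update x i t j - y j|)
        (Finset.mem_univ i)] at this
    have e : ∑ j ∈ Finset.univ.erase i, ∫ y in K, |Function.update x i t j - y j|
        = ∑ j ∈ Finset.univ.erase i, ∫ y in K, |x j - y j| := by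
      refine Finset.sum_congr rfl fun j hj => ?_
      rw [Function.update_of_ne (Finset.ne_of_mem_erase hj)]
    rw [e, Function.update_self] at this
    linarith
  · intro hb z
    rw [hfs, hfs]
    exact Finset.sum_le_sum fun i _ => (hone i).2 ((hR i).2 (hb i)) (z i)
end

section
/- Let K, L ⊂ ℝⁿ be compact sets. Then f_K(x) = f_L(x) for all x ∈ ℝⁿ if and only if for every i ∈ {1,…,n} the coordinate X-rays coincide almost everywhere: X_iK(t) = X_iL(t) for Lebesgue-almost every t ∈ ℝ. -/
open MeasureTheory
open scoped ENNReal

/-- The `i`-th coordinate X-ray of a set `K ⊆ ℝⁿ`: the `(n-1)`-dimensional Lebesgue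
measure of the hyperplane slice `{y ∈ K | y i = t}` (realized as a subset of the
coordinate hyperplane `{j // j ≠ i} → ℝ`). -/
noncomputable def coordXray (n : ℕ) (K : Set (Fin n → ℝ)) (i : Fin n) (t : ℝ) : ℝ :=
  (volume {z : {j : Fin n // j ≠ i} → ℝ |
    (fun j => if h : j = i then t else z ⟨j, h⟩) ∈ K}).toReal

lemma aux_step (s h : ℝ) (hh : 0 < h) (t : ℝ) : ‖(|s + h - t| - |s - t|) / h‖ ≤ 1 := by
  rw [Real.norm_eq_abs, abs_div, abs_of_pos hh, div_le_one hh]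
  refine (abs_abs_sub_abs_le_abs_sub _ _).trans ?_
  rw [show s + h - t - (s - t) = h by ring, abs_of_pos hh]

lemma aux_lim_sign (μ : Measure ℝ) [IsFiniteMeasure μ]
    (hμ : ∀ s : ℝ, Integrable (fun t => |s - t|) μ) (s : ℝ) :
    Filter.Tendsto (fun k : ℕ => ((∫ t, |s + 1 / ((k : ℝ) + 1) - t| ∂μ) - ∫ t, |s - t| ∂μ)
        / (1 / ((k : ℝ) + 1)))
      Filter.atTop (nhds (2 * μ.real (Set.Iic s) - μ.real Set.univ)) := by
  have e1 : ∀ k : ℕ, ((∫ t, |s + 1 / ((k : ℝ) + 1) - t| ∂μ) - ∫ t, |s - t| ∂μ)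
        / (1 / ((k : ℝ) + 1)) =
      ∫ t, (|s + 1 / ((k : ℝ) + 1) - t| - |s - t|) / (1 / ((k : ℝ) + 1)) ∂μ := by
    intro k
    rw [integral_div, integral_sub (hμ _) (hμ _)]
  have e2 : 2 * μ.real (Set.Iic s) - μ.real Set.univ =
      ∫ t, (2 * (Set.Iic s).indicator (fun _ => (1 : ℝ)) t - 1) ∂μ := by
    have hi : Integrable ((Set.Iic s).indicator (fun _ => (1 : ℝ))) μ :=
      (integrable_const 1).indicator measurableSet_Iic
    rw [integral_sub (hi.const_mul 2) (integrable_const 1), integral_const_mul,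
      integral_indicator measurableSet_Iic]
    simp
  simp_rw [e1]
  rw [e2]
  refine tendsto_integral_of_dominated_convergence (fun _ => (1 : ℝ)) ?_ (integrable_const 1) ?_ ?_
  · intro k
    exact (((hμ _).sub (hμ _)).div_const _).aestronglyMeasurable
  · intro k
    exact Filter.Eventually.of_forall (fun t => aux_step s _ (by positivity) t)
  · refine Filter.Eventually.of_forall (fun t => ?_)
    by_cases hts : t ≤ s
    · refine tendsto_const_nhds.congr (fun k => ?_)
      have hk : (0 : ℝ) < 1 / ((k : ℝ) + 1) := by positivity
      rw [Set.indicator_of_mem (show t ∈ Set.Iic s from hts),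
        abs_of_nonneg (by linarith), abs_of_nonneg (by linarith)]
      rw [show s + 1 / ((k : ℝ) + 1) - t - (s - t) = 1 / ((k : ℝ) + 1) by ring, div_self hk.ne']
      norm_num
    · have hts' : 0 < t - s := by linarith [not_le.1 hts]
      refine tendsto_const_nhds.congr' ?_
      have hev : ∀ᶠ k : ℕ in Filter.atTop, 1 / ((k : ℝ) + 1) < t - s :=
        (tendsto_one_div_add_atTop_nhds_zero_nat (𝕜 := ℝ)).eventually_lt_const hts'
      filter_upwards [hev] with k hkt
      have hk : (0 : ℝ) < 1 / ((k : ℝ) + 1) := by positivity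
      rw [Set.indicator_of_notMem (show t ∉ Set.Iic s from hts),
        abs_of_nonpos (by linarith), abs_of_nonpos (by linarith)]
      rw [show -(s + 1 / ((k : ℝ) + 1) - t) - -(s - t) = -(1 / ((k : ℝ) + 1)) by ring,
        neg_div, div_self hk.ne']
      norm_num

lemma aux_lim_mass (μ : Measure ℝ) [IsFiniteMeasure μ]
    (hμ : ∀ s : ℝ, Integrable (fun t => |s - t|) μ) :
    Filter.Tendsto (fun k : ℕ => ((∫ t, |(k : ℝ) + 1 - t| ∂μ) - ∫ t, |(k : ℝ) - t| ∂μ))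
      Filter.atTop (nhds (μ.real Set.univ)) := by
  have e2 : μ.real Set.univ = ∫ t, (1 : ℝ) ∂μ := by simp
  rw [e2]
  have e1 : ∀ k : ℕ, ((∫ t, |(k : ℝ) + 1 - t| ∂μ) - ∫ t, |(k : ℝ) - t| ∂μ) =
      ∫ t, (|(k : ℝ) + 1 - t| - |(k : ℝ) - t|) / 1 ∂μ := by
    intro k
    rw [integral_div, integral_sub (hμ _) (hμ _), div_one]
  simp_rw [e1]
  refine tendsto_integral_of_dominated_convergence (fun _ => (1 : ℝ)) ?_ (integrable_const 1) ?_ ?_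
  · intro k
    exact (((hμ _).sub (hμ _)).div_const _).aestronglyMeasurable
  · intro k
    exact Filter.Eventually.of_forall (fun t => aux_step _ _ one_pos t)
  · refine Filter.Eventually.of_forall (fun t => ?_)
    refine tendsto_const_nhds.congr' ?_
    filter_upwards [(tendsto_natCast_atTop_atTop (R := ℝ)).eventually_ge_atTop t] with k hk
    rw [abs_of_nonneg (by linarith), abs_of_nonneg (by linarith)]
    ring

lemma aux_unique (μ ν : Measure ℝ) [IsFiniteMeasure μ] [IsFiniteMeasure ν]
    (hμ : ∀ s : ℝ, Integrable (fun t => |s - t|) μ)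
    (hν : ∀ s : ℝ, Integrable (fun t => |s - t|) ν) (c : ℝ)
    (h : ∀ s : ℝ, (∫ t, |s - t| ∂μ) = (∫ t, |s - t| ∂ν) + c) : μ = ν := by
  have hm : μ.real Set.univ = ν.real Set.univ := by
    refine tendsto_nhds_unique (aux_lim_mass μ hμ) ((aux_lim_mass ν hν).congr (fun k => ?_))
    rw [h, h]; ring
  refine Measure.ext_of_Iic μ ν (fun s => ?_)
  have hs : 2 * μ.real (Set.Iic s) - μ.real Set.univ =
      2 * ν.real (Set.Iic s) - ν.real Set.univ := by
    refine tendsto_nhds_unique (aux_lim_sign μ hμ s) ((aux_lim_sign ν hν s).congr (fun k => ?_))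
    rw [h, h]; congr 1; ring
  have : μ.real (Set.Iic s) = ν.real (Set.Iic s) := by linarith
  exact (measureReal_eq_measureReal_iff).1 this

lemma aux_slice_lt_top (n : ℕ) (K : Set (Fin n → ℝ)) (hK : IsCompact K) (i : Fin n) (t : ℝ) :
    volume {z : {j : Fin n // j ≠ i} → ℝ |
      (fun j => if h : j = i then t else z ⟨j, h⟩) ∈ K} < ⊤ := by
  have hc : IsCompact ((fun (y : Fin n → ℝ) (j : {j : Fin n // j ≠ i}) => y j.1) '' K) :=
    hK.image (by fun_prop)
  refine lt_of_le_of_lt (measure_mono ?_) hc.measure_lt_top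
  intro z hz
  refine ⟨_, hz, ?_⟩
  funext j
  simp [j.2]

lemma aux_glue_measurable (n : ℕ) (i : Fin n) :
    Measurable (fun (p : ℝ × ({j : Fin n // j ≠ i} → ℝ)) (j : Fin n) =>
      if h : j = i then p.1 else p.2 ⟨j, h⟩) := by
  refine measurable_pi_lambda _ (fun j => ?_)
  by_cases h : j = i
  · simp only [h, dite_true]; exact measurable_fst
  · simp only [h, dite_false]; fun_prop

lemma aux_glue (n : ℕ) (i : Fin n) :
    MeasurePreserving (fun (p : ℝ × ({j : Fin n // j ≠ i} → ℝ)) (j : Fin n) =>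
      if h : j = i then p.1 else p.2 ⟨j, h⟩)
      ((volume : Measure ℝ).prod (volume : Measure ({j : Fin n // j ≠ i} → ℝ))) volume := by
  refine ⟨aux_glue_measurable n i, ?_⟩
  symm
  refine Measure.pi_eq (fun s hs => ?_)
  rw [Measure.map_apply (aux_glue_measurable n i) (MeasurableSet.univ_pi hs)]
  have : (fun (p : ℝ × ({j : Fin n // j ≠ i} → ℝ)) (j : Fin n) =>
      if h : j = i then p.1 else p.2 ⟨j, h⟩) ⁻¹' (Set.univ.pi s) =
      (s i) ×ˢ (Set.univ.pi (fun j : {j : Fin n // j ≠ i} => s j.1)) := by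
    ext p
    simp only [Set.mem_preimage, Set.mem_pi, Set.mem_univ, true_imp_iff, Set.mem_prod]
    constructor
    · intro h
      refine ⟨by simpa using h i, fun j => ?_⟩
      simpa [j.2] using h j.1
    · rintro ⟨h1, h2⟩ j
      by_cases h : j = i
      · subst h; simpa using h1
      · simpa [h] using h2 ⟨j, h⟩
  rw [this, Measure.prod_prod, volume_pi_pi]
  rw [← Finset.mul_prod_erase Finset.univ _ (Finset.mem_univ i)]
  congr 1
  exact (Finset.prod_subtype (Finset.univ.erase i) (by simp) (fun j => volume (s j))).symm

lemma aux_density (n : ℕ) (K : Set (Fin n → ℝ)) (hK : IsCompact K) (i : Fin n) :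
    Measurable (fun t => volume {z : {j : Fin n // j ≠ i} → ℝ |
      (fun j => if h : j = i then t else z ⟨j, h⟩) ∈ K}) ∧
    Measure.map (fun y : Fin n → ℝ => y i) (volume.restrict K) =
      (volume : Measure ℝ).withDensity (fun t => volume {z : {j : Fin n // j ≠ i} → ℝ |
      (fun j => if h : j = i then t else z ⟨j, h⟩) ∈ K}) := by
  have hm := measurable_measure_prodMk_left (ν := (volume : Measure ({j : Fin n // j ≠ i} → ℝ)))
    (aux_glue_measurable n i hK.measurableSet)
  refine ⟨hm, ?_⟩
  ext A hA
  have hAm : MeasurableSet ((fun y : Fin n → ℝ => y i) ⁻¹' A) := measurable_pi_apply i hA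
  rw [Measure.map_apply (measurable_pi_apply i) hA, Measure.restrict_apply hAm,
    withDensity_apply _ hA,
    ← (aux_glue n i).measure_preimage (hAm.inter hK.measurableSet).nullMeasurableSet,
    Measure.prod_apply (aux_glue_measurable n i (hAm.inter hK.measurableSet)),
    ← lintegral_indicator hA]
  refine lintegral_congr (fun t => ?_)
  by_cases ht : t ∈ A
  · rw [Set.indicator_of_mem ht]
    congr 1
    ext z
    simp [ht]
  · rw [Set.indicator_of_notMem ht]
    convert measure_empty (μ := (volume : Measure ({j : Fin n // j ≠ i} → ℝ)))
    ext z
    simp [ht]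

lemma aux_xray_iff (n : ℕ) (K L : Set (Fin n → ℝ)) (hK : IsCompact K) (hL : IsCompact L)
    (i : Fin n) : (∀ᵐ t : ℝ, coordXray n K i t = coordXray n L i t) ↔
    Measure.map (fun y : Fin n → ℝ => y i) (volume.restrict K) =
      Measure.map (fun y : Fin n → ℝ => y i) (volume.restrict L) := by
  obtain ⟨mK, dK⟩ := aux_density n K hK i
  obtain ⟨mL, dL⟩ := aux_density n L hL i
  rw [dK, dL, withDensity_eq_iff_of_sigmaFinite mK.aemeasurable mL.aemeasurable]
  refine Filter.eventually_congr (Filter.Eventually.of_forall (fun t => ?_))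
  exact ENNReal.toReal_eq_toReal_iff' (aux_slice_lt_top n K hK i t).ne
    (aux_slice_lt_top n L hL i t).ne

lemma aux_integrable (n : ℕ) (K : Set (Fin n → ℝ)) (hK : IsCompact K) (i : Fin n) (s : ℝ) :
    Integrable (fun y : Fin n → ℝ => |s - y i|) (volume.restrict K) :=
  ContinuousOn.integrableOn_compact hK (by fun_prop)

lemma aux_integrable_map (n : ℕ) (K : Set (Fin n → ℝ)) (hK : IsCompact K) (i : Fin n) (s : ℝ) :
    Integrable (fun t => |s - t|)
      (Measure.map (fun y : Fin n → ℝ => y i) (volume.restrict K)) :=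
  (integrable_map_measure (f := fun y : Fin n → ℝ => y i) (g := fun t => |s - t|)
    (Continuous.aestronglyMeasurable (by fun_prop)) (measurable_pi_apply i).aemeasurable).2 (aux_integrable n K hK i s)

lemma aux_integral_map (n : ℕ) (K : Set (Fin n → ℝ)) (i : Fin n) (s : ℝ) :
    ∫ t, |s - t| ∂(Measure.map (fun y : Fin n → ℝ => y i) (volume.restrict K)) =
      ∫ y in K, |s - y i| :=
  integral_map (measurable_pi_apply i).aemeasurable (by fun_prop)


/-- Let `K, L ⊆ ℝⁿ` be compact sets, with taxicab distance mean
functions `f_K x = ∫_K d₁ x y dy`, `f_L x = ∫_L d₁ x y dy`. Then `f_K = f_L`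
if and only if for every `i` the `i`-th coordinate X-rays of `K` and `L` coincide
Lebesgue-almost everywhere. -/
theorem taxicab_distance_mean_functions_eq_iff_xrays_ae_eq
    (n : ℕ) (K L : Set (Fin n → ℝ)) (hK : IsCompact K) (hL : IsCompact L) :
    (∀ x : Fin n → ℝ, (∫ y in K, ∑ i, |x i - y i|) = ∫ y in L, ∑ i, |x i - y i|) ↔
      ∀ i, ∀ᵐ t : ℝ, coordXray n K i t = coordXray n L i t := by
  have hsum : ∀ M : Set (Fin n → ℝ), IsCompact M → ∀ x : Fin n → ℝ,
      (∫ y in M, ∑ i, |x i - y i|) = ∑ i, ∫ y in M, |x i - y i| := fun M hM x =>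
    integral_finsetSum _ (fun i _ => aux_integrable n M hM i (x i))
  constructor
  · intro h i
    rw [aux_xray_iff n K L hK hL i]
    have : IsFiniteMeasure (volume.restrict K) := ⟨by simpa using hK.measure_lt_top⟩
    have : IsFiniteMeasure (volume.restrict L) := ⟨by simpa using hL.measure_lt_top⟩
    refine aux_unique _ _ (aux_integrable_map n K hK i) (aux_integrable_map n L hL i)
      ((∑ j ∈ Finset.univ.erase i, ∫ y in L, |0 - y j|) -
        ∑ j ∈ Finset.univ.erase i, ∫ y in K, |0 - y j|) (fun s => ?_)
    rw [aux_integral_map, aux_integral_map]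
    have key : ∀ M : Set (Fin n → ℝ), IsCompact M →
        (∫ y in M, ∑ j, |(Function.update (0 : Fin n → ℝ) i s) j - y j|) =
        (∫ y in M, |s - y i|) + ∑ j ∈ Finset.univ.erase i, ∫ y in M, |0 - y j| := by
      intro M hM
      rw [hsum M hM, ← Finset.add_sum_erase Finset.univ _ (Finset.mem_univ i)]
      congr 1
      · simp
      · refine Finset.sum_congr rfl (fun j hj => ?_)
        rw [Function.update_of_ne (Finset.ne_of_mem_erase hj)]
        rfl
    have := h (Function.update (0 : Fin n → ℝ) i s)
    rw [key K hK, key L hL] at this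
    linarith
  · intro h x
    rw [hsum K hK, hsum L hL]
    refine Finset.sum_congr rfl (fun i _ => ?_)
    rw [← aux_integral_map, ← aux_integral_map, (aux_xray_iff n K L hK hL i).1 (h i)]
end

section
/- Let K and L_n (n ∈ ℕ) be nonempty compact subsets of ℝ². Then L_n converges to K in the Hausdorff metric if and only if for every ε > 0, lim_{n→∞} μ₂((L_n)_ε △ K_ε) = 0, where A_ε denotes the outer parallel body of A with radius ε and μ₂ is two-dimensional Lebesgue measure. -/
open MeasureTheory Filter Metric
open scoped ENNReal symmDiff

lemma aux_mem_cth {s : Set (EuclideanSpace ℝ (Fin 2))} (hs : s.Nonempty) {ε : ℝ} (hε : 0 < ε)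
    (x : EuclideanSpace ℝ (Fin 2)) : x ∈ cthickening ε s ↔ infDist x s ≤ ε := by
  rw [mem_cthickening_iff, infDist, ENNReal.le_ofReal_iff_toReal_le (infEDist_ne_top hs) hε.le]

lemma aux_null {K : Set (EuclideanSpace ℝ (Fin 2))} (hK : IsCompact K) (hKne : K.Nonempty)
    {ε : ℝ} (hε : 0 < ε) : volume {x | infDist x K = ε} = 0 := by
  set S := {x : EuclideanSpace ℝ (Fin 2) | infDist x K = ε} with hS
  have hSm : MeasurableSet S :=
    (isClosed_eq (continuous_infDist_pt K) continuous_const).measurableSet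
  have h := IsUnifLocDoublingMeasure.ae_tendsto_measure_inter_div
    (volume : Measure (EuclideanSpace ℝ (Fin 2))) S 2
  rw [ae_restrict_iff' hSm] at h
  have h2 : ∀ᵐ x ∂(volume : Measure (EuclideanSpace ℝ (Fin 2))), x ∉ S := by
    filter_upwards [h] with x hx hxS
    obtain ⟨y, hyK, hy⟩ := hK.exists_infDist_eq_dist hKne x
    have hxe : infDist x K = ε := hxS
    have hxy : ‖y - x‖ = ε := by rw [← dist_eq_norm, dist_comm, ← hy, hxe]
    have hlim : Tendsto (fun t : ℝ => t * ε / 2) (nhdsWithin 0 (Set.Ioi 0))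
        (nhdsWithin 0 (Set.Ioi 0)) := by
      refine tendsto_nhdsWithin_iff.2 ⟨?_, ?_⟩
      · have : Continuous (fun t : ℝ => t * ε / 2) := by fun_prop
        have h0 := this.tendsto 0
        simp only [zero_mul, zero_div] at h0
        exact h0.mono_left nhdsWithin_le_nhds
      · filter_upwards [self_mem_nhdsWithin] with t ht
        have : (0 : ℝ) < t := ht
        exact Set.mem_Ioi.2 (by positivity)
    have key := hx hxS (fun t : ℝ => x + t • (y - x)) (fun t => t * ε / 2) hlim (by
      filter_upwards [self_mem_nhdsWithin] with t ht
      have ht' : (0 : ℝ) < t := ht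
      rw [mem_closedBall, dist_eq_norm, sub_add_cancel_left, norm_neg, norm_smul, hxy,
        Real.norm_eq_abs, abs_of_pos ht']
      linarith)
    have hz : ∀ᶠ t in nhdsWithin (0 : ℝ) (Set.Ioi 0),
        volume (S ∩ closedBall (x + t • (y - x)) (t * ε / 2)) /
          volume (closedBall (x + t • (y - x)) (t * ε / 2)) = 0 := by
      filter_upwards [Ioo_mem_nhdsGT (zero_lt_one' ℝ)] with t ht
      have : S ∩ closedBall (x + t • (y - x)) (t * ε / 2) = ∅ := by
        rw [Set.eq_empty_iff_forall_notMem]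
        rintro z ⟨hzS, hzb⟩
        have hze : infDist z K = ε := hzS
        have h1 : infDist z K ≤ dist z y := infDist_le_dist_of_mem hyK
        have h3 : dist (x + t • (y - x)) y = (1 - t) * ε := by
          have : x + t • (y - x) - y = -((1 - t) • (y - x)) := by module
          rw [dist_eq_norm, this, norm_neg, norm_smul, hxy, Real.norm_eq_abs,
            abs_of_pos (by linarith [ht.2])]
        have h4 := dist_triangle z (x + t • (y - x)) y
        rw [mem_closedBall] at hzb
        have : 0 < t * ε := mul_pos ht.1 hε
        nlinarith
      rw [this]; simp
    have := tendsto_nhds_unique (key.congr' hz) tendsto_const_nhds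
    exact one_ne_zero this
  simpa [ae_iff] using h2

lemma aux_dev {A B : Set (EuclideanSpace ℝ (Fin 2))} (hA : A.Nonempty) (hB : B.Nonempty)
    {ε : ℝ} (hε : 0 < ε)
    (h : volume (cthickening ε A ∆ cthickening ε B) <
      volume (closedBall (0 : EuclideanSpace ℝ (Fin 2)) ε)) :
    ∀ x ∈ A, infDist x B ≤ 2 * ε := by
  intro x hx
  by_contra! hc
  refine absurd h (not_lt.2 ?_)
  rw [← Measure.addHaar_closedBall_center volume x ε]
  refine measure_mono fun z hz => Or.inl ⟨?_, ?_⟩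
  · exact closedBall_subset_cthickening hx ε hz
  · rw [aux_mem_cth hB hε]
    have := infDist_le_infDist_add_dist (s := B) (x := x) (y := z)
    rw [mem_closedBall, dist_comm] at hz
    linarith

/-- Let `K` and `Lₙ` be nonempty compact subsets of the Euclidean
plane. Then `Lₙ → K` in the Hausdorff metric if and only if for every `ε > 0` the
Lebesgue measure of the symmetric difference of the outer parallel bodies
`(Lₙ)_ε ∆ K_ε` tends to `0`. -/
theorem hausdorff_convergence_iff_symmDiff_of_parallel_bodies
    (K : Set (EuclideanSpace ℝ (Fin 2))) (hK : IsCompact K) (hKne : K.Nonempty)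
    (L : ℕ → Set (EuclideanSpace ℝ (Fin 2)))
    (hL : ∀ n, IsCompact (L n)) (hLne : ∀ n, (L n).Nonempty) :
    Tendsto (fun n => hausdorffDist (L n) K) atTop (nhds 0) ↔
      ∀ ε : ℝ, 0 < ε →
        Tendsto (fun n => volume (cthickening ε (L n) ∆ cthickening ε K))
          atTop (nhds 0) := by
  constructor
  · intro h ε hε
    set T : ℝ → Set (EuclideanSpace ℝ (Fin 2)) := fun η => {x | |infDist x K - ε| ≤ η} with hT
    have hTc : ∀ η, IsClosed (T η) := fun η =>
      isClosed_le ((continuous_infDist_pt K).sub continuous_const).abs continuous_const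
    have hlim : Tendsto (volume ∘ T) (nhdsWithin 0 (Set.Ioi 0))
        (nhds (volume (⋂ r > (0 : ℝ), T r))) := by
      apply tendsto_measure_biInter_gt
      · exact fun r _ => (hTc r).measurableSet.nullMeasurableSet
      · intro i j _ hij x hx
        exact le_trans (show |infDist x K - ε| ≤ i from hx) hij
      · refine ⟨1, one_pos, ?_⟩
        refine ((measure_mono ?_).trans_lt
          (hK.cthickening (r := ε + 1)).measure_lt_top).ne
        intro x hx
        rw [aux_mem_cth hKne (by linarith)]
        have : |infDist x K - ε| ≤ 1 := hx
        linarith [(abs_le.1 this).2]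
    have hz : volume (⋂ r > (0 : ℝ), T r) = 0 := by
      refine measure_mono_null ?_ (aux_null hK hKne hε)
      intro x hx
      simp only [Set.mem_iInter] at hx
      have : |infDist x K - ε| ≤ 0 := le_of_forall_gt_imp_ge_of_dense fun r hr => hx r hr
      exact sub_eq_zero.1 (abs_nonpos_iff.1 this)
    rw [hz] at hlim
    rw [ENNReal.tendsto_nhds_zero] at hlim ⊢
    intro δ hδ
    obtain ⟨η, hη, hη0⟩ := ((hlim δ hδ).and self_mem_nhdsWithin).exists
    filter_upwards [h.eventually_lt_const (show (0 : ℝ) < η from hη0)] with n hn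
    refine (measure_mono ?_).trans hη
    have fin : hausdorffEDist (L n) K ≠ ⊤ := hausdorffEDist_ne_top_of_nonempty_of_bounded
      (hLne n) hKne (hL n).isBounded hK.isBounded
    intro x hx
    have h1 := infDist_le_infDist_add_hausdorffDist (x := x) fin
    have h2 := infDist_le_infDist_add_hausdorffDist (x := x) (s := K) (t := L n)
      (by rwa [hausdorffEDist_comm])
    rw [hausdorffDist_comm] at h2
    rw [Set.mem_symmDiff, aux_mem_cth hKne hε, aux_mem_cth (hLne n) hε] at hx
    show |infDist x K - ε| ≤ η
    rw [abs_le]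
    rcases hx with ⟨a, b⟩ | ⟨a, b⟩ <;> constructor <;> linarith
  · intro h
    rw [Metric.tendsto_atTop']
    intro r hr
    have hr3 : 0 < r / 3 := by positivity
    have hc : 0 < volume (closedBall (0 : EuclideanSpace ℝ (Fin 2)) (r / 3)) :=
      measure_closedBall_pos volume _ hr3
    obtain ⟨N, hN⟩ := eventually_atTop.1 ((h _ hr3).eventually_lt_const hc)
    refine ⟨N, fun n hn => ?_⟩
    have h1 := hN n hn.le
    have := hausdorffDist_le_of_infDist (r := 2 * (r / 3)) (by positivity)
      (aux_dev (hLne n) hKne hr3 h1)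
      (aux_dev hKne (hLne n) hr3 (by rwa [symmDiff_comm]))
    rw [Real.dist_0_eq_abs, abs_of_nonneg hausdorffDist_nonneg]
    linarith
end

section
/- Let K and L_n (n ∈ ℕ) be nonempty compact subsets of ℝ². If L_n → K with respect to the Hausdorff metric, then for every x ∈ ℝ², limsup_{n→∞} f_{L_n}(x) ≤ f_K(x). -/
open MeasureTheory Filter Metric
open scoped ENNReal

theorem mem_cth_aux {K : Set (EuclideanSpace ℝ (Fin 2))} {δ : ℝ} {y : EuclideanSpace ℝ (Fin 2)}
    (hδ : 0 ≤ δ) (hK : K.Nonempty) : y ∈ cthickening δ K ↔ infDist y K ≤ δ := by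
  rw [mem_cthickening_iff, infDist]
  exact ENNReal.le_ofReal_iff_toReal_le (infEDist_ne_top hK) hδ

/-- Let `K` and `Lₙ` be nonempty compact subsets of the Euclidean
plane, with taxicab distance mean functions `f_A x = ∫_A d₁ x y dy`,
`d₁ x y = |x 0 - y 0| + |x 1 - y 1|`. If `Lₙ → K` in the Hausdorff metric, then
`limsup_n f_{Lₙ} x ≤ f_K x` for every `x`. -/
theorem limsup_taxicab_distance_mean_le_of_hausdorff_convergence
    (K : Set (EuclideanSpace ℝ (Fin 2))) (hK : IsCompact K) (hKne : K.Nonempty)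
    (L : ℕ → Set (EuclideanSpace ℝ (Fin 2)))
    (hL : ∀ n, IsCompact (L n)) (hLne : ∀ n, (L n).Nonempty)
    (hconv : Tendsto (fun n => hausdorffDist (L n) K) atTop (nhds 0))
    (x : EuclideanSpace ℝ (Fin 2)) :
    limsup (fun n => ∫ y in L n, (|x 0 - y 0| + |x 1 - y 1|)) atTop ≤
      ∫ y in K, (|x 0 - y 0| + |x 1 - y 1|) := by
  have hg : Continuous (fun y : EuclideanSpace ℝ (Fin 2) => |x 0 - y 0| + |x 1 - y 1|) := by
    fun_prop
  set g : EuclideanSpace ℝ (Fin 2) → ℝ := fun y => |x 0 - y 0| + |x 1 - y 1| with hgdef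
  have hg0 : ∀ y, 0 ≤ g y := fun y => by simp only [hgdef]; positivity
  set C : ℕ → Set (EuclideanSpace ℝ (Fin 2)) :=
    fun k => cthickening (1 / ((k : ℝ) + 1)) K with hC
  have hCc : ∀ k, IsCompact (C k) := fun k => hK.cthickening
  have hint : ∀ k, IntegrableOn g (C k) := fun k => hg.continuousOn.integrableOn_compact (hCc k)
  have hanti : Antitone C := by
    intro a b hab
    exact cthickening_mono (Nat.one_div_le_one_div hab) K
  have hinter : ⋂ k, C k = K := by
    apply Set.Subset.antisymm
    · intro y hy
      rw [Set.mem_iInter] at hy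
      rw [← hK.isClosed.closure_eq, mem_closure_iff_infDist_zero hKne]
      refine le_antisymm ?_ infDist_nonneg
      refine ge_of_tendsto' (tendsto_one_div_add_atTop_nhds_zero_nat (𝕜 := ℝ)) fun k => ?_
      have h := hy k
      rwa [hC, mem_cth_aux (by positivity) hKne] at h
    · exact Set.subset_iInter fun k => self_subset_cthickening K
  have hlim : Tendsto (fun k => ∫ y in C k, g y) atTop (nhds (∫ y in K, g y)) := by
    rw [← hinter]
    exact tendsto_setIntegral_of_antitone (fun k => (hCc k).measurableSet) hanti ⟨0, hint 0⟩
  refine ge_of_tendsto' hlim fun k => ?_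
  have hev : ∀ᶠ n in atTop, hausdorffDist (L n) K < 1 / ((k : ℝ) + 1) :=
    hconv.eventually_lt_const (by positivity)
  refine limsup_le_of_le ?_ ?_
  · exact isCoboundedUnder_le_of_le atTop (x := 0)
      fun n => integral_nonneg (μ := volume.restrict (L n)) hg0
  · filter_upwards [hev] with n hn
    refine setIntegral_mono_set (hint k) (Eventually.of_forall hg0) ?_
    refine LE.le.eventuallyLE ?_
    intro y hy
    have hfin := hausdorffEDist_ne_top_of_nonempty_of_bounded (hLne n) hKne
      (hL n).isBounded hK.isBounded
    rw [hC, mem_cth_aux (by positivity) hKne]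
    exact (infDist_le_hausdorffDist_of_mem hy hfin).trans hn.le
end

section
/- Let K and L_n (n ∈ ℕ) be nonempty compact subsets of ℝ². If L_n → K with respect to the Hausdorff metric and the convergence is regular, i.e. lim_{n→∞} μ₂(L_n) = μ₂(K), then f_{L_n}(x) → f_K(x) for every x ∈ ℝ², and the convergence f_{L_n} → f_K is uniform on every compact subset of ℝ². -/
open MeasureTheory Filter Metric
open scoped ENNReal

theorem aux_diff_bound {T A : Set (EuclideanSpace ℝ (Fin 2))} (hT : IsCompact T)
    (hA : IsCompact A) (hAT : A ⊆ T) {g : EuclideanSpace ℝ (Fin 2) → ℝ} (hg : Continuous g)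
    {M : ℝ} (hM : ∀ y ∈ T, ‖g y‖ ≤ M) :
    |(∫ y in T, g y) - ∫ y in A, g y| ≤ M * (volume.real T - volume.real A) := by
  rw [← setIntegral_sdiff hA.measurableSet (hg.continuousOn.integrableOn_compact hT) hAT,
    ← measureReal_sdiff hAT hA.measurableSet hT.measure_lt_top.ne]
  exact norm_setIntegral_le_of_norm_le_const
    (lt_of_le_of_lt (measure_mono Set.diff_subset) hT.measure_lt_top)
    (fun y hy => hM y hy.1)

/-- Let `K` and `Lₙ` be nonempty compact subsets of the Euclidean
plane, with taxicab distance mean functions `f_A x = ∫_A d₁ x y dy`,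
`d₁ x y = |x 0 - y 0| + |x 1 - y 1|`. If `Lₙ → K` in the Hausdorff metric and the
convergence is regular, i.e. `μ₂ (Lₙ) → μ₂ K`, then `f_{Lₙ} x → f_K x` for every `x`,
and the convergence `f_{Lₙ} → f_K` is uniform on every compact subset of the plane. -/
theorem regular_hausdorff_convergence_implies_convergence_of_distance_mean
    (K : Set (EuclideanSpace ℝ (Fin 2))) (hK : IsCompact K) (hKne : K.Nonempty)
    (L : ℕ → Set (EuclideanSpace ℝ (Fin 2)))
    (hL : ∀ n, IsCompact (L n)) (hLne : ∀ n, (L n).Nonempty)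
    (hconv : Tendsto (fun n => hausdorffDist (L n) K) atTop (nhds 0))
    (hreg : Tendsto (fun n => volume (L n)) atTop (nhds (volume K))) :
    (∀ x : EuclideanSpace ℝ (Fin 2),
      Tendsto (fun n => ∫ y in L n, (|x 0 - y 0| + |x 1 - y 1|)) atTop
        (nhds (∫ y in K, (|x 0 - y 0| + |x 1 - y 1|)))) ∧
    (∀ C : Set (EuclideanSpace ℝ (Fin 2)), IsCompact C →
      TendstoUniformlyOn
        (fun n x => ∫ y in L n, (|x 0 - y 0| + |x 1 - y 1|))
        (fun x => ∫ y in K, (|x 0 - y 0| + |x 1 - y 1|)) atTop C) := by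
  have key : ∀ C : Set (EuclideanSpace ℝ (Fin 2)), IsCompact C →
      TendstoUniformlyOn
        (fun n x => ∫ y in L n, (|x 0 - y 0| + |x 1 - y 1|))
        (fun x => ∫ y in K, (|x 0 - y 0| + |x 1 - y 1|)) atTop C := by
    intro C hC
    have hcont : Continuous (fun p : EuclideanSpace ℝ (Fin 2) × EuclideanSpace ℝ (Fin 2) =>
        |p.1 0 - p.2 0| + |p.1 1 - p.2 1|) := by fun_prop
    obtain ⟨M, hM⟩ := (hC.prod (hK.cthickening (r := 1))).exists_bound_of_continuousOn
      hcont.continuousOn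
    rw [Metric.tendstoUniformlyOn_iff]
    intro ε hε
    have hM0 : 0 < |M| + 1 := by positivity
    obtain ⟨η, hη, hηε⟩ : ∃ η : ℝ, 0 < η ∧ (|M| + 1) * (3 * η) = ε :=
      ⟨ε / (3 * (|M| + 1)), by positivity, by field_simp⟩
    have hKfin := hK.measure_lt_top (μ := volume)
    have hT : Tendsto (fun r => volume.real (cthickening r K)) (nhds 0)
        (nhds (volume.real K)) :=
      (ENNReal.tendsto_toReal hKfin.ne).comp (tendsto_measure_cthickening_of_isCompact hK)
    have hLr : Tendsto (fun n => volume.real (L n)) atTop (nhds (volume.real K)) :=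
      (ENNReal.tendsto_toReal hKfin.ne).comp hreg
    have h1 := hT.eventually_lt_const (show volume.real K < volume.real K + η by linarith)
    obtain ⟨δ, hδ, hδT⟩ := Metric.eventually_nhds_iff.1 h1
    obtain ⟨r, hr0, hr1, hrT⟩ : ∃ r : ℝ, 0 < r ∧ r ≤ 1 ∧
        volume.real (cthickening r K) < volume.real K + η := by
      refine ⟨min (δ / 2) 1, by positivity, min_le_right _ _, hδT ?_⟩
      rw [Real.dist_eq, sub_zero, abs_of_pos (by positivity)]
      exact lt_of_le_of_lt (min_le_left _ _) (by linarith)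
    filter_upwards [hconv.eventually_lt_const hr0,
      hLr.eventually_const_lt (show volume.real K - η < volume.real K by linarith)]
      with n hn1 hn2 x hx
    have hsub : L n ⊆ cthickening r K := by
      intro y hy
      have hfin := hausdorffEDist_ne_top_of_nonempty_of_bounded (hLne n) hKne
        (hL n).isBounded hK.isBounded
      obtain ⟨z, hz, hyz⟩ := exists_dist_lt_of_hausdorffDist_lt hy hn1 hfin
      exact mem_cthickening_of_dist_le y z r K hz hyz.le
    have hg : Continuous (fun y : EuclideanSpace ℝ (Fin 2) =>
        |x 0 - y 0| + |x 1 - y 1|) := by fun_prop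
    have hb : ∀ y ∈ cthickening r K, ‖|x 0 - y 0| + |x 1 - y 1|‖ ≤ |M| + 1 := by
      intro y hy
      have := hM (x, y) ⟨hx, cthickening_mono hr1 K hy⟩
      have h2 := le_abs_self M
      simp only at this
      linarith
    have e1 := aux_diff_bound hK.cthickening (hL n) hsub hg hb
    have e2 := aux_diff_bound hK.cthickening hK (self_subset_cthickening K) hg hb
    have e3 : (|M| + 1) * ((volume.real (cthickening r K) - volume.real (L n)) +
        (volume.real (cthickening r K) - volume.real K)) < (|M| + 1) * (3 * η) :=
      mul_lt_mul_of_pos_left (by linarith) hM0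
    rw [mul_add] at e3
    rw [Real.dist_eq, abs_lt]
    rw [abs_le] at e1 e2
    constructor <;> linarith [e1.1, e1.2, e2.1, e2.2]
  exact ⟨fun x => (key {x} isCompact_singleton).tendsto_at rfl, key⟩
end

section
/- Let K and L_n (n ∈ ℕ) be nonempty compact subsets of ℝ². If L_n → K with respect to the Hausdorff metric and the convergence is X-regular, i.e. lim_{n→∞} μ₂(I_n) = μ₂(K) where I_n = ⋂_{i=n}^∞ L_i, then the convergence is also regular (lim_{n→∞} μ₂(L_n) = μ₂(K)), and the coordinate X-rays converge almost everywhere: X₁L_n(t) → X₁K(t) and X₂L_n(t) → X₂K(t) for Lebesgue-almost every t ∈ ℝ. -/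
open MeasureTheory Filter Metric
open scoped ENNReal

/-- The first coordinate X-ray of a planar set `A`:
`X₁A t = μ₁ {y ∈ A | y 0 = t}`, the one-dimensional Lebesgue measure of the vertical
slice of `A` at abscissa `t`. -/
noncomputable def xray1 (A : Set (EuclideanSpace ℝ (Fin 2))) (t : ℝ) : ℝ :=
  (volume {s : ℝ | (WithLp.equiv 2 (Fin 2 → ℝ)).symm ![t, s] ∈ A}).toReal

/-- The second coordinate X-ray of a planar set `A`:
`X₂A t = μ₁ {y ∈ A | y 1 = t}`, the one-dimensional Lebesgue measure of the horizontal
slice of `A` at ordinate `t`. -/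
noncomputable def xray2 (A : Set (EuclideanSpace ℝ (Fin 2))) (t : ℝ) : ℝ :=
  (volume {s : ℝ | (WithLp.equiv 2 (Fin 2 → ℝ)).symm ![s, t] ∈ A}).toReal

theorem slice_tendsto_aux (K : Set (EuclideanSpace ℝ (Fin 2))) (hK : IsCompact K)
    (L : ℕ → Set (EuclideanSpace ℝ (Fin 2))) (hL : ∀ n, IsCompact (L n)) (R : ℝ)
    (hR : ∀ᶠ n in atTop, L n ⊆ closedBall 0 R) (hKR : K ⊆ closedBall 0 R)
    (f : ℝ → EuclideanSpace ℝ (Fin 2)) (hf : Continuous f) (hfn : ∀ s, ‖s‖ ≤ ‖f s‖)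
    (h : ∀ᵐ s : ℝ, ∀ᶠ n in atTop, (f s ∈ L n ↔ f s ∈ K)) :
    Tendsto (fun n => (volume {s : ℝ | f s ∈ L n}).toReal) atTop
      (nhds (volume {s : ℝ | f s ∈ K}).toReal) := by
  have sub : ∀ A : Set (EuclideanSpace ℝ (Fin 2)), A ⊆ closedBall 0 R →
      {s : ℝ | f s ∈ A} ⊆ closedBall 0 R := by
    intro A hA s hs
    have h1 := hA hs
    rw [mem_closedBall_zero_iff] at h1 ⊢
    exact (hfn s).trans h1
  have fin : volume (closedBall (0 : ℝ) R) ≠ ∞ := measure_closedBall_lt_top.ne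
  refine (ENNReal.tendsto_toReal (measure_ne_top_of_subset (sub K hKR) fin)).comp ?_
  refine tendsto_measure_of_ae_tendsto_indicator atTop
    (hf.measurable hK.isClosed.measurableSet)
    (fun n => hf.measurable (hL n).isClosed.measurableSet)
    measurableSet_closedBall fin ?_ h
  filter_upwards [hR] with n hn using sub _ hn

theorem ae_slices_aux (p : EuclideanSpace ℝ (Fin 2) → Prop) (h : ∀ᵐ x, p x) :
    (∀ᵐ t : ℝ, ∀ᵐ s : ℝ, p ((WithLp.equiv 2 (Fin 2 → ℝ)).symm ![t, s])) ∧
    (∀ᵐ t : ℝ, ∀ᵐ s : ℝ, p ((WithLp.equiv 2 (Fin 2 → ℝ)).symm ![s, t])) := by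
  have e := (PiLp.volume_preserving_toLp (Fin 2)).comp
    (volume_preserving_finTwoArrow ℝ).symm
  have h1 : ∀ᵐ z : ℝ × ℝ, p ((WithLp.equiv 2 (Fin 2 → ℝ)).symm ![z.1, z.2]) :=
    e.quasiMeasurePreserving.ae h
  have h2 : ∀ᵐ z : ℝ × ℝ, p ((WithLp.equiv 2 (Fin 2 → ℝ)).symm ![z.2, z.1]) :=
    (Measure.measurePreserving_swap (μ := (volume : Measure ℝ))
      (ν := (volume : Measure ℝ))).quasiMeasurePreserving.ae h1
  exact ⟨Measure.ae_ae_of_ae_prod h1, Measure.ae_ae_of_ae_prod h2⟩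

/-- Let `K` and `Lₙ` be nonempty compact subsets of the Euclidean
plane. If `Lₙ → K` in the Hausdorff metric and the convergence is X-regular, i.e.
`μ₂ Iₙ → μ₂ K` where `Iₙ = ⋂_{i ≥ n} L i`, then the convergence is also regular
(`μ₂ (Lₙ) → μ₂ K`) and the coordinate X-rays of `Lₙ` converge to those of `K`
Lebesgue-almost everywhere. -/
theorem Xregular_hausdorff_convergence_implies_regular_and_xray_convergence
    (K : Set (EuclideanSpace ℝ (Fin 2))) (hK : IsCompact K) (hKne : K.Nonempty)
    (L : ℕ → Set (EuclideanSpace ℝ (Fin 2)))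
    (hL : ∀ n, IsCompact (L n)) (hLne : ∀ n, (L n).Nonempty)
    (hconv : Tendsto (fun n => hausdorffDist (L n) K) atTop (nhds 0))
    (hXreg : Tendsto (fun n => volume (⋂ i, ⋂ (_ : n ≤ i), L i)) atTop
      (nhds (volume K))) :
    Tendsto (fun n => volume (L n)) atTop (nhds (volume K)) ∧
    (∀ᵐ t : ℝ, Tendsto (fun n => xray1 (L n) t) atTop (nhds (xray1 K t))) ∧
    (∀ᵐ t : ℝ, Tendsto (fun n => xray2 (L n) t) atTop (nhds (xray2 K t))) := by
  have hfin : ∀ n, hausdorffEDist (L n) K ≠ ⊤ := fun n =>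
    hausdorffEDist_ne_top_of_nonempty_of_bounded (hLne n) hKne (hL n).isBounded hK.isBounded
  have hout : ∀ x, x ∉ K → ∀ᶠ n in atTop, x ∉ L n := by
    intro x hx
    have hpos : 0 < infDist x K := (hK.isClosed.notMem_iff_infDist_pos hKne).1 hx
    filter_upwards [hconv.eventually (gt_mem_nhds hpos)] with n hn hxn
    exact absurd (infDist_le_hausdorffDist_of_mem hxn (hfin n)) (not_le.2 hn)
  obtain ⟨r, hr⟩ := hK.isBounded.subset_closedBall (0 : EuclideanSpace ℝ (Fin 2))
  have hKR : K ⊆ closedBall 0 (r + 1) := hr.trans (closedBall_subset_closedBall (by linarith))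
  have hLR : ∀ᶠ n in atTop, L n ⊆ closedBall 0 (r + 1) := by
    filter_upwards [hconv.eventually (gt_mem_nhds one_pos)] with n hn x hx
    obtain ⟨y, hy, hxy⟩ := exists_dist_lt_of_hausdorffDist_lt hx hn (hfin n)
    have h1 := hr hy
    rw [mem_closedBall] at h1 ⊢
    linarith [dist_triangle x y 0]
  have hmono : Monotone (fun n => ⋂ i, ⋂ (_ : n ≤ i), L i) := by
    intro a b hab x hx
    simp only [Set.mem_iInter] at hx ⊢
    exact fun i hi => hx i (hab.trans hi)
  have hmeas : MeasurableSet (⋃ n, ⋂ i, ⋂ (_ : n ≤ i), L i) :=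
    MeasurableSet.iUnion fun n => MeasurableSet.iInter fun i => MeasurableSet.iInter fun _ =>
      (hL i).isClosed.measurableSet
  have hU : volume (⋃ n, ⋂ i, ⋂ (_ : n ≤ i), L i) = volume K :=
    tendsto_nhds_unique (tendsto_measure_iUnion_atTop hmono) hXreg
  have hsub : (⋃ n, ⋂ i, ⋂ (_ : n ≤ i), L i) ⊆ K := by
    intro x hx
    simp only [Set.mem_iUnion, Set.mem_iInter] at hx
    obtain ⟨n, hn⟩ := hx
    by_contra hxK
    obtain ⟨m, hm1, hm2⟩ := ((hout x hxK).and (eventually_ge_atTop n)).exists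
    exact hm1 (hn m hm2)
  have hae := ae_eq_of_subset_of_measure_ge hsub hU.ge hmeas.nullMeasurableSet
    hK.measure_lt_top.ne
  have hP : ∀ᵐ x : EuclideanSpace ℝ (Fin 2), ∀ᶠ n in atTop, (x ∈ L n ↔ x ∈ K) := by
    filter_upwards [hae.mem_iff] with x hx
    by_cases hxK : x ∈ K
    · have h1 := hx.2 hxK
      simp only [Set.mem_iUnion, Set.mem_iInter] at h1
      obtain ⟨n, hn⟩ := h1
      filter_upwards [eventually_ge_atTop n] with m hm
      exact iff_of_true (hn m hm) hxK
    · filter_upwards [hout x hxK] with n hn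
      exact iff_of_false hn hxK
  refine ⟨tendsto_measure_of_ae_tendsto_indicator atTop hK.isClosed.measurableSet
    (fun n => (hL n).isClosed.measurableSet) measurableSet_closedBall
    measure_closedBall_lt_top.ne hLR hP, ?_, ?_⟩
  · filter_upwards [(ae_slices_aux _ hP).1] with t ht
    refine slice_tendsto_aux K hK L hL (r + 1) hLR hKR
      (fun s => (WithLp.equiv 2 (Fin 2 → ℝ)).symm ![t, s]) ?_ ?_ ht
    · refine (PiLp.continuous_toLp 2 _).comp (continuous_pi fun i => ?_)
      fin_cases i <;> simp <;> fun_prop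
    · intro s
      simpa using PiLp.norm_apply_le ((WithLp.equiv 2 (Fin 2 → ℝ)).symm ![t, s]) 1
  · filter_upwards [(ae_slices_aux _ hP).2] with t ht
    refine slice_tendsto_aux K hK L hL (r + 1) hLR hKR
      (fun s => (WithLp.equiv 2 (Fin 2 → ℝ)).symm ![s, t]) ?_ ?_ ht
    · refine (PiLp.continuous_toLp 2 _).comp (continuous_pi fun i => ?_)
      fin_cases i <;> simp <;> fun_prop
    · intro s
      simpa using PiLp.norm_apply_le ((WithLp.equiv 2 (Fin 2 → ℝ)).symm ![s, t]) 0
end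

section
/- Let L_n (n ∈ ℕ) be a sequence of nonempty compact connected hv-convex subsets of ℝ² converging to a nonempty compact set K with respect to the Hausdorff metric. Then the convergence is regular, i.e. lim_{n→∞} μ₂(L_n) = μ₂(K). -/
open MeasureTheory Filter Metric
open scoped ENNReal

/-- A planar set is hv-convex if its intersection with every horizontal line and every
vertical line is connected (possibly empty). -/
def HvConvex (A : Set (EuclideanSpace ℝ (Fin 2))) : Prop :=
  (∀ t : ℝ, IsPreconnected {p : EuclideanSpace ℝ (Fin 2) | p ∈ A ∧ p 1 = t}) ∧
  (∀ t : ℝ, IsPreconnected {p : EuclideanSpace ℝ (Fin 2) | p ∈ A ∧ p 0 = t})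


lemma hv_open1 (s t : ℝ) (x : EuclideanSpace ℝ (Fin 2)) : IsOpen {p : EuclideanSpace ℝ (Fin 2) | 0 < s * (p 0 - x 0) ∧ 0 < t * (p 1 - x 1)} := by
  rw [Set.setOf_and]
  apply IsOpen.inter
  · exact isOpen_lt (by fun_prop) (by fun_prop)
  · exact isOpen_lt (by fun_prop) (by fun_prop)

lemma hv_open2 (s t : ℝ) (x : EuclideanSpace ℝ (Fin 2)) : IsOpen {p : EuclideanSpace ℝ (Fin 2) | s * (p 0 - x 0) < 0 ∨ t * (p 1 - x 1) < 0} := by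
  rw [Set.setOf_or]
  apply IsOpen.union
  · exact isOpen_lt (by fun_prop) (by fun_prop)
  · exact isOpen_lt (by fun_prop) (by fun_prop)

lemma hv_open3 (s t : ℝ) (x : EuclideanSpace ℝ (Fin 2)) : IsOpen {p : EuclideanSpace ℝ (Fin 2) | 0 < s * (x 0 - p 0) ∧ 0 < t * (x 1 - p 1)} := by
  rw [Set.setOf_and]
  apply IsOpen.inter
  · exact isOpen_lt (by fun_prop) (by fun_prop)
  · exact isOpen_lt (by fun_prop) (by fun_prop)

/-- A preconnected set whose `i`-th coordinate avoids `a` lies on one side of `a`. -/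
lemma hv_line_side (S : Set (EuclideanSpace ℝ (Fin 2))) (i : Fin 2) (a : ℝ)
    (hS : IsPreconnected S) (ha : ∀ p ∈ S, p i ≠ a) :
    ∃ s : ℝ, (s = 1 ∨ s = -1) ∧ ∀ p ∈ S, s * (p i - a) < 0 := by
  have himg : IsPreconnected ((fun p : EuclideanSpace ℝ (Fin 2) => p i) '' S) :=
    hS.image _ (by fun_prop)
  have hoc := himg.ordConnected
  by_cases h : ∃ p ∈ S, a < p i
  · obtain ⟨p, hp, hpa⟩ := h
    refine ⟨-1, Or.inr rfl, fun q hq => ?_⟩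
    by_contra hcon
    have hqa : q i ≤ a := by linarith
    obtain ⟨r, hr, hra⟩ := hoc.out ⟨q, hq, rfl⟩ ⟨p, hp, rfl⟩ (⟨hqa, hpa.le⟩ : a ∈ Set.Icc (q i) (p i))
    exact ha r hr hra
  · push Not at h
    refine ⟨1, Or.inl rfl, fun q hq => ?_⟩
    have := lt_of_le_of_ne (h q hq) (ha q hq)
    linarith

lemma hv_quadrant (A : Set (EuclideanSpace ℝ (Fin 2))) (hc : IsConnected A) (hA : HvConvex A)
    (x : EuclideanSpace ℝ (Fin 2)) (hx : x ∉ A) :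
    ∃ s t : ℝ, (s = 1 ∨ s = -1) ∧ (t = 1 ∨ t = -1) ∧
      ∀ p ∈ A, ¬ (0 < s * (p 0 - x 0) ∧ 0 < t * (p 1 - x 1)) := by
  obtain ⟨s, hs, hs'⟩ := hv_line_side _ 0 (x 0) (hA.1 (x 1)) (by
    rintro p ⟨hp, h1⟩ h0
    apply hx
    have : x = p := by ext i; fin_cases i <;> simp_all
    rwa [this])
  obtain ⟨t, ht, ht'⟩ := hv_line_side _ 1 (x 1) (hA.2 (x 0)) (by
    rintro p ⟨hp, h1⟩ h0
    apply hx
    have : x = p := by ext i; fin_cases i <;> simp_all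
    rwa [this])
  have hs0 : s ≠ 0 := by rcases hs with rfl | rfl <;> norm_num
  have ht0 : t ≠ 0 := by rcases ht with rfl | rfl <;> norm_num
  have key := IsPreconnected.subset_or_subset
    (u := {p : EuclideanSpace ℝ (Fin 2) | 0 < s * (p 0 - x 0) ∧ 0 < t * (p 1 - x 1)})
    (v := {p : EuclideanSpace ℝ (Fin 2) | s * (p 0 - x 0) < 0 ∨ t * (p 1 - x 1) < 0})
    (s := A)
    (hv_open1 s t x)
    (hv_open2 s t x)
    (by
      rw [Set.disjoint_left]
      rintro p ⟨h1, h2⟩ (h3 | h3) <;> linarith)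
    (by
      intro p hp
      by_cases h0 : p 0 = x 0
      · exact Or.inr (Or.inr (ht' p ⟨hp, h0⟩))
      by_cases h1 : p 1 = x 1
      · exact Or.inr (Or.inl (hs' p ⟨hp, h1⟩))
      have e0 : s * (p 0 - x 0) ≠ 0 := mul_ne_zero hs0 (sub_ne_zero.2 h0)
      have e1 : t * (p 1 - x 1) ≠ 0 := mul_ne_zero ht0 (sub_ne_zero.2 h1)
      rcases lt_or_gt_of_ne e0 with h | h
      · exact Or.inr (Or.inl h)
      rcases lt_or_gt_of_ne e1 with h' | h'
      · exact Or.inr (Or.inr h')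
      exact Or.inl ⟨h, h'⟩)
    hc.isPreconnected
  rcases key with h | h
  · refine ⟨-s, -t, by rcases hs with rfl | rfl <;> simp, by rcases ht with rfl | rfl <;> simp, ?_⟩
    rintro p hp ⟨h1, h2⟩
    have := (h hp).1
    linarith
  · refine ⟨s, t, hs, ht, ?_⟩
    rintro p hp ⟨h1, h2⟩
    rcases h hp with h3 | h3 <;> linarith

lemma hv_null (K : Set (EuclideanSpace ℝ (Fin 2))) (hK : IsCompact K) (s t : ℝ)
    (hs : s = 1 ∨ s = -1) (ht : t = 1 ∨ t = -1) :
    volume {x ∈ K | ∀ p ∈ K, ¬ (0 < s * (p 0 - x 0) ∧ 0 < t * (p 1 - x 1))} = 0 := by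
  set N := {x ∈ K | ∀ p ∈ K, ¬ (0 < s * (p 0 - x 0) ∧ 0 < t * (p 1 - x 1))} with hN
  have hss : s * s = 1 := by rcases hs with rfl | rfl <;> norm_num
  have htt : t * t = 1 := by rcases ht with rfl | rfl <;> norm_num
  have hmeas : MeasurableSet N := by
    have : N = K ∩ ⋂ p ∈ K, {x : EuclideanSpace ℝ (Fin 2) |
        0 < s * (p 0 - x 0) ∧ 0 < t * (p 1 - x 1)}ᶜ := by
      ext x; simp [hN]
    rw [this]
    refine (hK.isClosed.inter (isClosed_biInter fun p _ => IsOpen.isClosed_compl ?_)).measurableSet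
    exact hv_open3 s t p
  set v : EuclideanSpace ℝ (Fin 2) := !₂[s, t] with hv
  have key : ∀ a b : ℝ, a < b → ∀ y ∈ N, ∀ z ∈ N, a • v + y = b • v + z → False := by
    intro a b hab y hy z hz h
    have h0 := congrArg (fun p : EuclideanSpace ℝ (Fin 2) => p 0) h
    have h1 := congrArg (fun p : EuclideanSpace ℝ (Fin 2) => p 1) h
    simp [hv] at h0 h1
    refine hz.2 y hy.1 ⟨?_, ?_⟩
    · have : y 0 - z 0 = (b - a) * s := by linarith
      rw [this]; nlinarith
    · have : y 1 - z 1 = (b - a) * t := by linarith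
      rw [this]; nlinarith
  refine Measure.addHaar_eq_zero_of_disjoint_translates volume
    (u := fun n : ℕ => ((1 : ℝ) / ((n : ℝ) + 1)) • v) ?_ ?_ hmeas
  · have : Tendsto (fun n : ℕ => ((1 : ℝ) / ((n : ℝ) + 1)) • v) atTop (nhds ((0:ℝ) • v)) :=
      tendsto_one_div_add_atTop_nhds_zero_nat.smul_const v
    exact Metric.isBounded_range_of_tendsto _ this
  · intro m n hmn
    rw [Function.onFun, Set.disjoint_left]
    rintro _ ⟨_, rfl, y, hy, rfl⟩ ⟨_, rfl, z, hz, h⟩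
    simp only at h
    rcases lt_or_gt_of_ne hmn with hlt | hlt
    · exact key _ _ (Nat.one_div_lt_one_div hlt) z hz y hy h
    · exact key _ _ (Nat.one_div_lt_one_div hlt) y hy z hz h.symm

theorem hausdorff_convergence_of_hv_convex_sets_is_regular
    (K : Set (EuclideanSpace ℝ (Fin 2))) (hK : IsCompact K) (hKne : K.Nonempty)
    (L : ℕ → Set (EuclideanSpace ℝ (Fin 2)))
    (hL : ∀ n, IsCompact (L n)) (hLconn : ∀ n, IsConnected (L n))
    (hLhv : ∀ n, HvConvex (L n))
    (hconv : Tendsto (fun n => hausdorffDist (L n) K) atTop (nhds 0)) :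
    Tendsto (fun n => volume (L n)) atTop (nhds (volume K)) := by
  have hfin : ∀ n, hausdorffEDist (L n) K ≠ ⊤ := fun n =>
    hausdorffEDist_ne_top_of_nonempty_of_bounded (hLconn n).nonempty hKne
      (hL n).isBounded hK.isBounded
  refine tendsto_of_le_liminf_of_limsup_le ?_ ?_
  · -- lower bound
    have hae : ∀ᵐ x ∂volume, x ∈ K → ∀ᶠ n in atTop, x ∈ L n := by
      have hn : ∀ s ∈ ({1, -1} : Set ℝ), ∀ t ∈ ({1, -1} : Set ℝ), ∀ᵐ x ∂volume,
          x ∉ {x ∈ K | ∀ p ∈ K, ¬ (0 < s * (p 0 - x 0) ∧ 0 < t * (p 1 - x 1))} :=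
        fun s hs t ht => measure_eq_zero_iff_ae_notMem.1 (hv_null K hK s t hs ht)
      filter_upwards [hn 1 (by simp) 1 (by simp), hn 1 (by simp) (-1) (by simp),
        hn (-1) (by simp) 1 (by simp), hn (-1) (by simp) (-1) (by simp)] with x h1 h2 h3 h4 hx
      have ev : ∀ s t : ℝ, x ∉ {x ∈ K | ∀ p ∈ K, ¬ (0 < s * (p 0 - x 0) ∧ 0 < t * (p 1 - x 1))} →
          ∀ᶠ n in atTop, ∃ p ∈ L n, 0 < s * (p 0 - x 0) ∧ 0 < t * (p 1 - x 1) := by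
        intro s t h
        have : ∃ p ∈ K, 0 < s * (p 0 - x 0) ∧ 0 < t * (p 1 - x 1) := by
          by_contra hcon
          exact h ⟨hx, fun p hp hh => hcon ⟨p, hp, hh⟩⟩
        obtain ⟨p, hp, hpq⟩ := this
        have hopen : IsOpen {p : EuclideanSpace ℝ (Fin 2) |
            0 < s * (p 0 - x 0) ∧ 0 < t * (p 1 - x 1)} :=
          hv_open1 s t x
        obtain ⟨r, hr, hball⟩ := Metric.isOpen_iff.1 hopen p hpq
        filter_upwards [hconv.eventually_lt_const hr] with n hn
        obtain ⟨q, hq, hd⟩ := exists_dist_lt_of_hausdorffDist_lt' hp hn (hfin n)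
        exact ⟨q, hq, hball hd⟩
      filter_upwards [ev _ _ h1, ev _ _ h2, ev _ _ h3, ev _ _ h4] with n e1 e2 e3 e4
      by_contra hxn
      obtain ⟨s, t, hs, ht, hd⟩ := hv_quadrant (L n) (hLconn n) (hLhv n) x hxn
      rcases hs with rfl | rfl <;> rcases ht with rfl | rfl
      · obtain ⟨p, hp, h⟩ := e1; exact hd p hp h
      · obtain ⟨p, hp, h⟩ := e2; exact hd p hp h
      · obtain ⟨p, hp, h⟩ := e3; exact hd p hp h
      · obtain ⟨p, hp, h⟩ := e4; exact hd p hp h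
    calc volume K = ∫⁻ x, K.indicator (fun _ => (1 : ℝ≥0∞)) x := by
          rw [lintegral_indicator_const hK.measurableSet, one_mul]
      _ ≤ ∫⁻ x, liminf (fun n => (L n).indicator (fun _ => (1 : ℝ≥0∞)) x) atTop := by
          apply lintegral_mono_ae
          filter_upwards [hae] with x hx
          by_cases hxK : x ∈ K
          · simp only [Set.indicator_of_mem hxK]
            apply le_liminf_of_le
            · isBoundedDefault
            · filter_upwards [hx hxK] with n hn
              simp [hn]
          · simp [hxK]
      _ ≤ liminf (fun n => ∫⁻ x, (L n).indicator (fun _ => (1 : ℝ≥0∞)) x) atTop :=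
          lintegral_liminf_le fun n => measurable_const.indicator (hL n).measurableSet
      _ = _ := by
          congr 1; ext n
          rw [lintegral_indicator_const (hL n).measurableSet, one_mul]
  · -- upper bound
    have hT : Tendsto (fun n => volume (cthickening (hausdorffDist (L n) K) K)) atTop
        (nhds (volume K)) := (tendsto_measure_cthickening_of_isCompact hK).comp hconv
    rw [← hT.limsup_eq]
    refine limsup_le_limsup (Eventually.of_forall fun n => measure_mono fun x hx => ?_)
    have := infEDist_le_hausdorffEDist_of_mem (t := K) hx
    rw [mem_cthickening_iff, hausdorffDist, ENNReal.ofReal_toReal (hfin n)]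
    exact this
end

section
/- Let L_n (n ∈ ℕ) be a sequence of nonempty compact convex subsets of ℝ² converging with respect to the Hausdorff metric to a compact convex set K with nonempty interior. Then the convergence is X-regular, i.e. lim_{n→∞} μ₂(⋂_{i=n}^∞ L_i) = μ₂(K). -/
open MeasureTheory Filter Metric
open scoped ENNReal

/-- Let `Lₙ` be a sequence of nonempty compact convex subsets of the
Euclidean plane converging in the Hausdorff metric to a compact convex set `K` with
nonempty interior. Then the convergence is X-regular:
`μ₂ (⋂_{i ≥ n} L i) → μ₂ K`. -/
theorem hausdorff_convergence_of_convex_bodies_is_Xregular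
    (K : Set (EuclideanSpace ℝ (Fin 2))) (hK : IsCompact K)
    (hKconv : Convex ℝ K) (hKint : (interior K).Nonempty)
    (L : ℕ → Set (EuclideanSpace ℝ (Fin 2)))
    (hL : ∀ n, IsCompact (L n)) (hLne : ∀ n, (L n).Nonempty)
    (hLconv : ∀ n, Convex ℝ (L n))
    (hconv : Tendsto (fun n => hausdorffDist (L n) K) atTop (nhds 0)) :
    Tendsto (fun n => volume (⋂ i, ⋂ (_ : n ≤ i), L i)) atTop
      (nhds (volume K)) := by
  have hKne : K.Nonempty := hKint.mono interior_subset
  have hfin : ∀ i, hausdorffEDist (L i) K ≠ ⊤ := fun i =>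
    hausdorffEDist_ne_top_of_nonempty_of_bounded (hLne i) hKne (hL i).isBounded hK.isBounded
  have hmono : Monotone (fun n => ⋂ i, ⋂ (_ : n ≤ i), L i) := by
    intro m n hmn x hx
    simp only [Set.mem_iInter] at hx ⊢
    exact fun i hi => hx i (hmn.trans hi)
  have h1 := tendsto_measure_iUnion_atTop (μ := volume) hmono
  have hsub : (⋃ n, ⋂ i, ⋂ (_ : n ≤ i), L i) ⊆ K := by
    intro x hx
    simp only [Set.mem_iUnion, Set.mem_iInter] at hx
    obtain ⟨n, hn⟩ := hx
    have h0 : infDist x K ≤ 0 := by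
      refine ge_of_tendsto hconv ?_
      filter_upwards [eventually_ge_atTop n] with i hi
      exact infDist_le_hausdorffDist_of_mem (hn i hi) (hfin i)
    rw [hK.isClosed.mem_iff_infDist_zero hKne]
    exact le_antisymm h0 infDist_nonneg
  have hsup : interior K ⊆ ⋃ n, ⋂ i, ⋂ (_ : n ≤ i), L i := by
    intro x hx
    obtain ⟨r, hr, hball⟩ := nhds_basis_closedBall.mem_iff.1 (mem_interior_iff_mem_nhds.1 hx)
    obtain ⟨n, hn⟩ := eventually_atTop.1 (hconv.eventually (gt_mem_nhds hr))
    simp only [Set.mem_iUnion, Set.mem_iInter]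
    refine ⟨n, fun i hi => ?_⟩
    by_contra hxL
    obtain ⟨f, u, hfu, hux⟩ := geometric_hahn_banach_closed_point (hLconv i) (hL i).isClosed hxL
    obtain ⟨a, rfl⟩ := (InnerProductSpace.toDual ℝ (EuclideanSpace ℝ (Fin 2))).surjective f
    simp only [InnerProductSpace.toDual_apply_apply] at hfu hux
    have ha : a ≠ 0 := by
      rintro rfl
      obtain ⟨w, hw⟩ := hLne i
      have := hfu w hw
      simp at this hux
      linarith
    have hna : 0 < ‖a‖ := norm_pos_iff.2 ha
    have hy : x + (r / ‖a‖) • a ∈ K := by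
      apply hball
      rw [mem_closedBall, dist_eq_norm, add_sub_cancel_left, norm_smul, norm_div, norm_norm,
        Real.norm_of_nonneg hr.le, div_mul_cancel₀ _ hna.ne']
    obtain ⟨w, hw, hd⟩ := exists_dist_lt_of_hausdorffDist_lt' hy (hn i hi) (hfin i)
    have h2 := hfu w hw
    have h3 := real_inner_le_norm a (x + (r / ‖a‖) • a - w)
    rw [inner_sub_right, inner_add_right, inner_smul_right, real_inner_self_eq_norm_sq] at h3
    have h4 : ‖x + (r / ‖a‖) • a - w‖ < r := by
      rw [← dist_eq_norm, dist_comm]; exact hd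
    have h5 : r / ‖a‖ * ‖a‖ ^ 2 = ‖a‖ * r := by field_simp
    have h6 := mul_lt_mul_of_pos_left h4 hna
    linarith
  have hint : volume (interior K) = volume K :=
    measure_congr (interior_ae_eq_of_null_frontier (hKconv.addHaar_frontier volume))
  have : volume (⋃ n, ⋂ i, ⋂ (_ : n ≤ i), L i) = volume K :=
    le_antisymm (measure_mono hsub) (hint ▸ measure_mono hsup)
  rw [← this]
  exact h1
end

section
/- (Mirsky) Let r_i', r_i'', s_j', s_j'', c_{ij} be integers with 0 ≤ r_i' ≤ r_i'' for i = 1,…,m, 0 ≤ s_j' ≤ s_j'' for j = 1,…,n, and c_{ij} ≥ 0 for all i, j. Then there exists an m × n integer matrix A = (a_{ij}) with r_i' ≤ ∑_{j=1}^n a_{ij} ≤ r_i'' for all i, with s_j' ≤ ∑_{i=1}^m a_{ij} ≤ s_j'' for all j, and with 0 ≤ a_{ij} ≤ c_{ij} for all i, j, if and only if for all subsets I ⊂ {1,…,m} and J ⊂ {1,…,n}: ∑_{i∈I} ∑_{j∈J} c_{ij} ≥ max{ ∑_{i∈I} r_i' − ∑_{j∉J} s_j'', ∑_{j∈J} s_j'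 − ∑_{i∉I} r_i'' }. -/
def mkT {V : Type*} [DecidableEq V] (l u : V → V → ℤ) (X : Finset V) (a b : V) : ℤ :=
  if a ∉ X ∧ b ∈ X then u a b else if a ∈ X ∧ b ∉ X then - l a b else 0

def mkCut {V : Type*} [DecidableEq V] [Fintype V] (l u : V → V → ℤ) (X : Finset V) : ℤ :=
  ∑ a, ∑ b, mkT l u X a b

def mkInc {V : Type*} [DecidableEq V] (p q : V) (a b : V) : ℤ :=
  if a = p then (if b = q then 1 else 0) else 0

lemma mkInc_sum {V : Type*} [DecidableEq V] [Fintype V] (p q : V) :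
    ∑ a, ∑ b, mkInc p q a b = 1 := by
  unfold mkInc
  rw [Finset.sum_eq_single p] <;> simp +contextual

lemma mk_submod {V : Type*} [DecidableEq V] [Fintype V] (l u : V → V → ℤ)
    (hlu : ∀ a b, l a b ≤ u a b) (X Y : Finset V) (p q : V) (hpq : l p q < u p q)
    (hpX : p ∈ X) (hqX : q ∉ X) (hpY : p ∉ Y) (hqY : q ∈ Y) :
    mkCut l u (X ∩ Y) + mkCut l u (X ∪ Y) + 1 ≤ mkCut l u X + mkCut l u Y := by
  rw [← mkInc_sum p q]
  unfold mkCut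
  simp only [← Finset.sum_add_distrib]
  refine Finset.sum_le_sum fun a _ => Finset.sum_le_sum fun b _ => ?_
  have h := hlu a b
  by_cases hab : a = p ∧ b = q
  · obtain ⟨rfl, rfl⟩ := hab
    simp [mkT, mkInc, *]
  · have : mkInc p q a b = 0 := by
      unfold mkInc; split_ifs <;> simp_all
    rw [this]
    by_cases h1 : a ∈ X <;> by_cases h2 : a ∈ Y <;> by_cases h3 : b ∈ X <;>
      by_cases h4 : b ∈ Y <;> simp [mkT, h1, h2, h3, h4] <;> omega

lemma mk_raise {V : Type*} [DecidableEq V] [Fintype V] (l u : V → V → ℤ) (X : Finset V) (p q : V) :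
    mkCut (fun a b => l a b + mkInc p q a b) u X
      = mkCut l u X - if p ∈ X ∧ q ∉ X then 1 else 0 := by
  have : (if p ∈ X ∧ q ∉ X then (1:ℤ) else 0)
      = ∑ a, ∑ b, (if p ∈ X ∧ q ∉ X then mkInc p q a b else 0) := by
    split_ifs
    · rw [mkInc_sum]
    · simp
  rw [this]
  unfold mkCut
  simp only [← Finset.sum_sub_distrib]
  refine Finset.sum_congr rfl fun a _ => Finset.sum_congr rfl fun b _ => ?_
  simp only [mkT, mkInc]
  grind

lemma mk_lower {V : Type*} [DecidableEq V] [Fintype V] (l u : V → V → ℤ) (X : Finset V) (p q : V) :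
    mkCut l (fun a b => u a b - mkInc p q a b) X
      = mkCut l u X - if p ∉ X ∧ q ∈ X then 1 else 0 := by
  have : (if p ∉ X ∧ q ∈ X then (1:ℤ) else 0)
      = ∑ a, ∑ b, (if p ∉ X ∧ q ∈ X then mkInc p q a b else 0) := by
    split_ifs
    · rw [mkInc_sum]
    · simp
  rw [this]
  unfold mkCut
  simp only [← Finset.sum_sub_distrib]
  refine Finset.sum_congr rfl fun a _ => Finset.sum_congr rfl fun b _ => ?_
  simp only [mkT, mkInc]
  grind

lemma mk_base {V : Type*} [DecidableEq V] [Fintype V] (l : V → V → ℤ)  (X : Finset V) :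
    mkCut l l X = ∑ v ∈ X, (∑ a, l a v - ∑ b, l v b) := by
  have e : ∀ a b, mkT l l X a b = (if b ∈ X then l a b else 0) - (if a ∈ X then l a b else 0) := by
    intro a b; unfold mkT; grind
  unfold mkCut
  simp only [e, Finset.sum_sub_distrib]
  rw [Finset.sum_comm]
  simp only [Finset.sum_ite_irrel, Finset.sum_const_zero, Finset.sum_ite_mem, Finset.univ_inter]

theorem mk_hoffman {V : Type*} [DecidableEq V] [Fintype V] (N : ℕ) : ∀ (l u : V → V → ℤ)
    (_ : ∀ a b, l a b ≤ u a b) (_ : ∑ a, ∑ b, (u a b - l a b) = N)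
    (_ : ∀ X, 0 ≤ mkCut l u X),
    ∃ x : V → V → ℤ, (∀ a b, l a b ≤ x a b ∧ x a b ≤ u a b) ∧
      ∀ v, ∑ a, x a v = ∑ b, x v b := by
  induction N with
  | zero =>
    intro l u hlu hN hX
    have hz : ∀ a b, u a b - l a b = 0 := by
      intro a b
      have h1 := (Finset.sum_eq_zero_iff_of_nonneg (fun a _ => Finset.sum_nonneg
        (fun b _ => sub_nonneg.2 (hlu a b)))).1 (by simpa using hN) a (Finset.mem_univ _)
      exact (Finset.sum_eq_zero_iff_of_nonneg
        (fun b _ => sub_nonneg.2 (hlu a b))).1 h1 b (Finset.mem_univ _)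
    have hu : u = l := by ext a b; linarith [hz a b]
    subst hu
    refine ⟨u, fun a b => ⟨le_rfl, le_rfl⟩, fun v => ?_⟩
    have h1 := hX {v}
    have h2 := hX Finset.univ
    have h3 := hX ({v}ᶜ)
    have h4 : mkCut u u Finset.univ = 0 := by simp [mkCut, mkT]
    rw [mk_base] at h1 h3 h4
    rw [← Finset.sum_add_sum_compl {v}] at h4
    rw [Finset.sum_singleton] at h1 h4
    linarith
  | succ N ih =>
    intro l u hlu hN hX
    have : ∃ p q, l p q < u p q := by
      by_contra! h
      have : ∑ a, ∑ b, (u a b - l a b) ≤ 0 :=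
        Finset.sum_nonpos fun a _ => Finset.sum_nonpos fun b _ => by linarith [h a b]
      push_cast at hN
      omega
    obtain ⟨p, q, hpq⟩ := this
    have hinc := mkInc_sum p q
    have hi0 : ∀ a b, 0 ≤ mkInc p q a b ∧ mkInc p q a b ≤ u a b - l a b := by
      intro a b
      have := hlu a b
      unfold mkInc
      grind
    by_cases hA : ∀ X, 0 ≤ mkCut (fun a b => l a b + mkInc p q a b) u X
    · obtain ⟨x, hx, hv⟩ := ih _ u (fun a b => by linarith [(hi0 a b).2]) (by
        simp only [← sub_sub, Finset.sum_sub_distrib, hinc] at hN ⊢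
        push_cast at hN
        linarith) hA
      exact ⟨x, fun a b => ⟨by linarith [(hi0 a b).1, (hx a b).1], (hx a b).2⟩, hv⟩
    by_cases hB : ∀ X, 0 ≤ mkCut l (fun a b => u a b - mkInc p q a b) X
    · obtain ⟨x, hx, hv⟩ := ih l _ (fun a b => by linarith [(hi0 a b).2]) (by
        simp only [Finset.sum_sub_distrib, hinc] at hN ⊢
        push_cast at hN
        linarith) hB
      exact ⟨x, fun a b => ⟨(hx a b).1, by linarith [(hi0 a b).1, (hx a b).2]⟩, hv⟩
    exfalso
    push Not at hA hB
    obtain ⟨X, hA⟩ := hA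
    obtain ⟨Y, hB⟩ := hB
    rw [mk_raise] at hA
    rw [mk_lower] at hB
    have hX1 := hX X
    have hY1 := hX Y
    split_ifs at hA with h1 <;> split_ifs at hB with h2 <;> try omega
    have := mk_submod l u hlu X Y p q hpq h1.1 h1.2 h2.1 h2.2
    have := hX (X ∩ Y)
    have := hX (X ∪ Y)
    omega

lemma mk_nec {α β : Type*} [Fintype α] [Fintype β] [DecidableEq α] [DecidableEq β]
    (r : α → ℤ) (s : β → ℤ) (c A : α → β → ℤ) (h1 : ∀ i, r i ≤ ∑ j, A i j)
    (h2 : ∀ j, ∑ i, A i j ≤ s j) (h3 : ∀ i j, 0 ≤ A i j ∧ A i j ≤ c i j)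
    (I : Finset α) (J : Finset β) :
    (∑ i ∈ I, r i) - ∑ j ∈ Jᶜ, s j ≤ ∑ i ∈ I, ∑ j ∈ J, c i j := by
  have e1 : ∑ i ∈ I, r i ≤ ∑ i ∈ I, ∑ j, A i j := Finset.sum_le_sum fun i _ => h1 i
  have e2 : ∑ j ∈ Jᶜ, ∑ i, A i j ≤ ∑ j ∈ Jᶜ, s j := Finset.sum_le_sum fun i _ => h2 i
  have e3 : ∑ i ∈ I, ∑ j ∈ J, A i j ≤ ∑ i ∈ I, ∑ j ∈ J, c i j :=
    Finset.sum_le_sum fun i _ => Finset.sum_le_sum fun j _ => (h3 i j).2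
  have e4 : ∑ i ∈ I, ∑ j, A i j = ∑ i ∈ I, ∑ j ∈ J, A i j + ∑ j ∈ Jᶜ, ∑ i ∈ I, A i j := by
    rw [Finset.sum_comm (s := Jᶜ), ← Finset.sum_add_distrib]
    exact Finset.sum_congr rfl fun i _ => (Finset.sum_add_sum_compl J _).symm
  have e5 : ∑ j ∈ Jᶜ, ∑ i ∈ I, A i j ≤ ∑ j ∈ Jᶜ, ∑ i, A i j :=
    Finset.sum_le_sum fun j _ => Finset.sum_le_sum_of_subset_of_nonneg (Finset.subset_univ _)
      fun i _ _ => (h3 i j).1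
  linarith

def mkE {α β : Type*} (r : α → ℤ) (s : β → ℤ) (c : α → β → ℤ) :
    Option (α ⊕ β) → Option (α ⊕ β) → ℤ
  | none, some (Sum.inl i) => r i
  | some (Sum.inl i), some (Sum.inr j) => c i j
  | some (Sum.inr j), none => s j
  | _, _ => 0


/-- **Mirsky.** Let `0 ≤ r'ᵢ ≤ r''ᵢ`, `0 ≤ s'ⱼ ≤ s''ⱼ` and `cᵢⱼ ≥ 0` be
integers. Then there exists an `m × n` integer matrix `A` with `r'ᵢ ≤ ∑ⱼ aᵢⱼ ≤ r''ᵢ`,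
`s'ⱼ ≤ ∑ᵢ aᵢⱼ ≤ s''ⱼ` and `0 ≤ aᵢⱼ ≤ cᵢⱼ` if and only if for all subsets
`I ⊆ {1,…,m}` and `J ⊆ {1,…,n}`:
`∑_{i∈I} ∑_{j∈J} cᵢⱼ ≥ max (∑_{i∈I} r'ᵢ - ∑_{j∉J} s''ⱼ) (∑_{j∈J} s'ⱼ - ∑_{i∉I} r''ᵢ)`. -/
theorem mirsky_integer_matrix_existence
    (m n : ℕ) (hm : 0 < m) (hn : 0 < n)
    (r' r'' : Fin m → ℤ) (s' s'' : Fin n → ℤ) (c : Fin m → Fin n → ℤ)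
    (hr : ∀ i, 0 ≤ r' i ∧ r' i ≤ r'' i)
    (hs : ∀ j, 0 ≤ s' j ∧ s' j ≤ s'' j)
    (hc : ∀ i j, 0 ≤ c i j) :
    (∃ A : Fin m → Fin n → ℤ,
        (∀ i, r' i ≤ ∑ j, A i j ∧ ∑ j, A i j ≤ r'' i) ∧
        (∀ j, s' j ≤ ∑ i, A i j ∧ ∑ i, A i j ≤ s'' j) ∧
        (∀ i j, 0 ≤ A i j ∧ A i j ≤ c i j)) ↔
      ∀ (I : Finset (Fin m)) (J : Finset (Fin n)),
        max ((∑ i ∈ I, r' i) - ∑ j ∈ Jᶜ, s'' j)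
            ((∑ j ∈ J, s' j) - ∑ i ∈ Iᶜ, r'' i) ≤
          ∑ i ∈ I, ∑ j ∈ J, c i j := by

  constructor
  · rintro ⟨A, h1, h2, h3⟩ I J
    refine max_le (mk_nec r' s'' c A (fun i => (h1 i).1) (fun i => (h2 i).2) h3 I J) ?_
    rw [Finset.sum_comm]
    exact mk_nec s' r'' (fun j i => c i j) (fun j i => A i j) (fun i => (h2 i).1)
      (fun i => (h1 i).2) (fun j i => h3 i j) J I
  · intro H
    have hlu : ∀ a b, mkE r' s' (fun _ _ => 0) a b ≤ mkE r'' s'' c a b := by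
      rintro (_ | i | j) (_ | i' | j') <;> simp [mkE, hr, hs, hc]
    have hcut : ∀ X, 0 ≤ mkCut (mkE r' s' (fun _ _ => 0)) (mkE r'' s'' c) X := by
      intro X
      have H' := H {i | some (Sum.inl i) ∉ X} {j | some (Sum.inr j) ∈ X}
      rw [max_le_iff] at H'
      obtain ⟨H1, H2⟩ := H'
      simp only [Finset.compl_filter, Finset.sum_filter, not_not] at H1 H2
      have e : ∀ i j, mkT (mkE r' s' (fun _ _ => 0)) (mkE r'' s'' c) X (some (Sum.inl i))
          (some (Sum.inr j)) = if some (Sum.inl i) ∉ X then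
            (if some (Sum.inr j) ∈ X then c i j else 0) else 0 := by
        intro i j; simp only [mkT, mkE]; grind
      have e' : ∀ i, (∑ j, if some (Sum.inl i) ∉ X then
            (if some (Sum.inr j) ∈ X then c i j else 0) else 0) =
            if some (Sum.inl i) ∉ X then
            (∑ j, if some (Sum.inr j) ∈ X then c i j else 0) else 0 := by
        intro i; split_ifs <;> simp
      unfold mkCut
      simp only [Fintype.sum_option, Fintype.sum_sum_type, e, Finset.sum_add_distrib, e']
      by_cases ho : none ∈ X
      · have e1 : ∑ i, mkT (mkE r' s' (fun _ _ => 0)) (mkE r'' s'' c) X none (some (Sum.inl i))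
            = - ∑ i, if some (Sum.inl i) ∉ X then r' i else 0 := by
          rw [← Finset.sum_neg_distrib]
          refine Finset.sum_congr rfl fun i _ => ?_
          simp only [mkT, mkE]; grind
        have e2 : ∑ j, mkT (mkE r' s' (fun _ _ => 0)) (mkE r'' s'' c) X (some (Sum.inr j)) none
            = ∑ j, if some (Sum.inr j) ∉ X then s'' j else 0 := by
          refine Finset.sum_congr rfl fun i _ => ?_
          simp only [mkT, mkE]; grind
        rw [e1, e2]
        simp only [mkT, mkE, neg_zero, ite_self, Finset.sum_const_zero]
        linarith
      · have e1 : ∑ i, mkT (mkE r' s' (fun _ _ => 0)) (mkE r'' s'' c) X none (some (Sum.inl i))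
            = ∑ i, if some (Sum.inl i) ∈ X then r'' i else 0 := by
          refine Finset.sum_congr rfl fun i _ => ?_
          simp only [mkT, mkE]; grind
        have e2 : ∑ j, mkT (mkE r' s' (fun _ _ => 0)) (mkE r'' s'' c) X (some (Sum.inr j)) none
            = - ∑ j, if some (Sum.inr j) ∈ X then s' j else 0 := by
          rw [← Finset.sum_neg_distrib]
          refine Finset.sum_congr rfl fun i _ => ?_
          simp only [mkT, mkE]; grind
        rw [e1, e2]
        simp only [mkT, mkE, neg_zero, ite_self, Finset.sum_const_zero]
        linarith
    obtain ⟨x, hx, hv⟩ := mk_hoffman _ _ _ hlu (Int.toNat_of_nonneg (Finset.sum_nonneg fun a _ =>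
      Finset.sum_nonneg fun b _ => sub_nonneg.2 (hlu a b))).symm hcut
    have hz : ∀ a b, mkE r' s' (fun _ _ => 0) a b = 0 → mkE r'' s'' c a b = 0 → x a b = 0 := by
      intro a b h1 h2
      have := hx a b
      omega
    refine ⟨fun i j => x (some (Sum.inl i)) (some (Sum.inr j)), fun i => ?_, fun j => ?_,
      fun i j => hx (some (Sum.inl i)) (some (Sum.inr j))⟩
    · have h1 := hv (some (Sum.inl i))
      have h2 := hx none (some (Sum.inl i))
      simp only [Fintype.sum_option, Fintype.sum_sum_type] at h1
      rw [Finset.sum_eq_zero (fun k _ => hz (some (Sum.inl k)) (some (Sum.inl i)) rfl rfl),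
        Finset.sum_eq_zero (fun k _ => hz (some (Sum.inr k)) (some (Sum.inl i)) rfl rfl),
        Finset.sum_eq_zero (fun k _ => hz (some (Sum.inl i)) (some (Sum.inl k)) rfl rfl),
        hz (some (Sum.inl i)) none rfl rfl] at h1
      simp only [mkE] at h2
      constructor <;> linarith
    · have h1 := hv (some (Sum.inr j))
      have h2 := hx (some (Sum.inr j)) none
      simp only [Fintype.sum_option, Fintype.sum_sum_type] at h1
      rw [Finset.sum_eq_zero (fun k _ => hz (some (Sum.inr j)) (some (Sum.inl k)) rfl rfl),
        Finset.sum_eq_zero (fun k _ => hz (some (Sum.inr k)) (some (Sum.inr j)) rfl rfl),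
        Finset.sum_eq_zero (fun k _ => hz (some (Sum.inr j)) (some (Sum.inr k)) rfl rfl),
        hz none (some (Sum.inr j)) rfl rfl] at h1
      simp only [mkE] at h2
      constructor <;> linarith
end

section
/- Let R = (r_1,…,r_m) and S = (s_1,…,s_n) be compatible integral vectors. Then the set 𝔄(R,S) of all m × n binary (0–1) matrices with row sums equal to R and column sums equal to S is nonempty if and only if for all subsets I ⊂ {1,…,m} and J ⊂ {1,…,n}: |I| · |J| ≥ ∑_{i∈I} r_i − ∑_{j∉J} s_j. -/
theorem aux_top (n : ℕ) (S : Fin n → ℤ) (r : ℕ) (hr : r ≤ n) :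
    ∃ K : Finset (Fin n), K.card = r ∧ ∀ j ∈ K, ∀ j', j' ∉ K → S j' ≤ S j := by
  induction r with
  | zero => exact ⟨∅, by simp⟩
  | succ r ih =>
    obtain ⟨K, hK, h⟩ := ih (by omega)
    have hne : (Kᶜ).Nonempty := by
      rw [← Finset.card_pos, Finset.card_compl, Fintype.card_fin]; omega
    obtain ⟨a, ha, hmax⟩ := Finset.exists_max_image Kᶜ S hne
    have ha' : a ∉ K := by simpa using ha
    refine ⟨insert a K, by rw [Finset.card_insert_of_notMem ha', hK], ?_⟩
    intro j hj j' hj'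
    have h1 : j' ∉ K := fun hh => hj' (Finset.mem_insert_of_mem hh)
    rcases Finset.mem_insert.1 hj with rfl | hj
    · exact hmax j' (by simpa using h1)
    · exact h j hj j' h1

theorem aux_main (n m : ℕ) : ∀ (R : Fin m → ℤ) (S : Fin n → ℤ)
    (_ : ∀ i, 0 ≤ R i ∧ R i ≤ (n : ℤ)) (_ : ∑ i, R i = ∑ j, S j)
    (_ : ∀ I : Finset (Fin m), ∑ i ∈ I, R i ≤ ∑ j, min (I.card : ℤ) (S j)),
    ∃ A : Fin m → Fin n → ℤ,
        (∀ i j, A i j = 0 ∨ A i j = 1) ∧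
        (∀ i, ∑ j, A i j = R i) ∧
        (∀ j, ∑ i, A i j = S j) := by
  induction m with
  | zero =>
    intro R S hR hsum hc
    refine ⟨fun _ _ => 0, by simp, fun i => i.elim0, ?_⟩
    have h0 := hc ∅
    simp only [Finset.sum_empty, Finset.card_empty, Nat.cast_zero] at h0
    have hz : ∀ j, 0 ≤ S j := by
      by_contra! hcon
      obtain ⟨j, hj⟩ := hcon
      have : ∑ j, min 0 (S j) < ∑ _j : Fin n, (0 : ℤ) :=
        Finset.sum_lt_sum (fun i _ => min_le_left _ _)
          ⟨j, Finset.mem_univ _, by rw [min_eq_right hj.le]; exact hj⟩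
      simp at this h0
      omega
    have hs : ∑ j, S j = 0 := by rw [← hsum]; simp
    have := (Finset.sum_eq_zero_iff_of_nonneg (fun j _ => hz j)).1 hs
    intro j
    simp [this j (Finset.mem_univ _)]
  | succ m ih =>
    intro R S hR hsum hc
    obtain ⟨r, hr⟩ := Int.eq_ofNat_of_zero_le (hR 0).1
    have hrn : r ≤ n := by have := (hR 0).2; omega
    obtain ⟨K, hK, htop⟩ := aux_top n S r hrn
    have hχ : ∑ j, (if j ∈ K then (1 : ℤ) else 0) = R 0 := by
      simp [hK, hr]
    rw [Fin.sum_univ_succ] at hsum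
    obtain ⟨A, hA, hAr, hAc⟩ := ih (fun i => R i.succ)
      (fun j => S j - if j ∈ K then 1 else 0) (fun i => hR _)
      (by rw [Finset.sum_sub_distrib, hχ]; linarith)
      (by
        intro I
        by_cases hcase : ∀ j ∈ K, (I.card : ℤ) < S j
        · have h1 := hc (I.map (Fin.succEmb m))
          rw [Finset.sum_map, Finset.card_map] at h1
          refine h1.trans (le_of_eq (Finset.sum_congr rfl fun j _ => ?_))
          split_ifs with hj
          · have := hcase j hj
            omega
          · simp
        · push Not at hcase
          obtain ⟨j0, hj0, hle⟩ := hcase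
          have hnot : (0 : Fin (m+1)) ∉ I.map (Fin.succEmb m) := by
            simp [Fin.succ_ne_zero]
          have h1 := hc (insert 0 (I.map (Fin.succEmb m)))
          rw [Finset.sum_insert hnot, Finset.card_insert_of_notMem hnot,
            Finset.sum_map, Finset.card_map] at h1
          have h2 : ∑ j, min (I.card : ℤ) (S j - if j ∈ K then 1 else 0)
              = ∑ j, (min ((I.card + 1 : ℕ) : ℤ) (S j) - if j ∈ K then 1 else 0) := by
            refine Finset.sum_congr rfl fun j _ => ?_
            split_ifs with hj
            · push_cast; omega
            · have := htop j0 hj0 j hj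
              push_cast; omega
          rw [h2, Finset.sum_sub_distrib, hχ]
          simp only [Fin.coe_succEmb] at h1
          linarith)
    refine ⟨Fin.cons (fun j => if j ∈ K then 1 else 0) A, ?_, ?_, ?_⟩
    · intro i j
      refine Fin.cases ?_ (fun i => ?_) i
      · simp only [Fin.cons_zero]; split_ifs <;> simp
      · simpa using hA i j
    · intro i
      refine Fin.cases ?_ (fun i => ?_) i
      · simpa only [Fin.cons_zero] using hχ
      · simpa using hAr i
    · intro j
      rw [Fin.sum_univ_succ]
      simp only [Fin.cons_zero, Fin.cons_succ, hAc]
      ring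

/-- Let `R = (r₁,…,r_m)` and `S = (s₁,…,s_n)` be compatible integral
vectors (`0 ≤ rᵢ ≤ n`, `0 ≤ sⱼ ≤ m`, `∑ rᵢ = ∑ sⱼ`). Then the set `𝔄(R,S)` of all
`m × n` binary matrices with row sums `R` and column sums `S` is nonempty if and only
if for all subsets `I ⊆ {1,…,m}` and `J ⊆ {1,…,n}`:
`|I| ⬝ |J| ≥ ∑_{i∈I} rᵢ - ∑_{j∉J} sⱼ`. -/
theorem binary_matrix_class_nonempty_iff
    (m n : ℕ) (R : Fin m → ℤ) (S : Fin n → ℤ)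
    (hR : ∀ i, 0 ≤ R i ∧ R i ≤ (n : ℤ))
    (hS : ∀ j, 0 ≤ S j ∧ S j ≤ (m : ℤ))
    (hcomp : ∑ i, R i = ∑ j, S j) :
    (∃ A : Fin m → Fin n → ℤ,
        (∀ i j, A i j = 0 ∨ A i j = 1) ∧
        (∀ i, ∑ j, A i j = R i) ∧
        (∀ j, ∑ i, A i j = S j)) ↔
      ∀ (I : Finset (Fin m)) (J : Finset (Fin n)),
        (∑ i ∈ I, R i) - ∑ j ∈ Jᶜ, S j ≤ (I.card : ℤ) * (J.card : ℤ) := by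
  constructor
  · rintro ⟨A, hA, hAr, hAc⟩ I J
    have h0 : ∀ i j, 0 ≤ A i j := fun i j => by rcases hA i j with h | h <;> omega
    have h1 : ∀ i j, A i j ≤ 1 := fun i j => by rcases hA i j with h | h <;> omega
    have e : ∑ i ∈ I, R i = ∑ j ∈ J, ∑ i ∈ I, A i j + ∑ j ∈ Jᶜ, ∑ i ∈ I, A i j := by
      rw [Finset.sum_add_sum_compl, Finset.sum_comm]
      exact Finset.sum_congr rfl fun i _ => (hAr i).symm
    have b1 : ∑ j ∈ J, ∑ i ∈ I, A i j ≤ ∑ j ∈ J, ∑ i ∈ I, (1 : ℤ) :=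
      Finset.sum_le_sum fun j _ => Finset.sum_le_sum fun i _ => h1 i j
    have b2 : ∑ j ∈ Jᶜ, ∑ i ∈ I, A i j ≤ ∑ j ∈ Jᶜ, S j :=
      Finset.sum_le_sum fun j _ => by
        rw [← hAc j]
        exact Finset.sum_le_sum_of_subset_of_nonneg (Finset.subset_univ _)
          fun i _ _ => h0 i j
    simp only [Finset.sum_const, nsmul_eq_mul, mul_one] at b1
    rw [mul_comm] at b1
    linarith
  · intro h
    refine aux_main n m R S hR hcomp fun I => ?_
    have h1 := h I (Finset.univ.filter fun j => (I.card : ℤ) ≤ S j)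
    set J := Finset.univ.filter fun j => (I.card : ℤ) ≤ S j with hJ
    have e1 : ∑ j ∈ J, min (I.card : ℤ) (S j) = (I.card : ℤ) * J.card := by
      rw [Finset.sum_congr rfl (g := fun _ => (I.card : ℤ))]
      · simp [mul_comm]
      · intro j hj
        exact min_eq_left (by simpa [hJ] using hj)
    have e2 : ∑ j ∈ Jᶜ, min (I.card : ℤ) (S j) = ∑ j ∈ Jᶜ, S j := by
      refine Finset.sum_congr rfl fun j hj => min_eq_right ?_
      have : S j < I.card := by simpa [hJ] using hj
      exact this.le
    rw [← Finset.sum_add_sum_compl J, e1, e2]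
    linarith
end

section
/- Let R = (r_1,…,r_m) and S = (s_1,…,s_n) be compatible integral vectors, and let δ = (δ_1,…,δ_m) and ε = (ε_1,…,ε_n) be integral vectors with 0 ≤ δ_i ≤ n − r_i for all i and 0 ≤ ε_j ≤ m − s_j for all j. Define I₀ = { i : δ_i > 0 } and J₀ = { j : ε_j > 0 }, and assume I₀ and J₀ are nonempty. If both 𝔄(R,S) and 𝔄(R+δ, S+ε) are nonempty, then there exist indices i' ∈ I₀ and j' ∈ J₀ and a matrix A = (a_{ij}) ∈ 𝔄(R,S) such that a_{i'j'} = 0. -/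
theorem swap_aux {m n : ℕ} (D : Fin m → Fin n → ℤ) (i0 i1 : Fin m) (j1 j2 : Fin n)
    (hi : i0 ≠ i1) (hj : j1 ≠ j2)
    (h1 : D i0 j1 = 1) (h2 : D i1 j1 = -1) (h3 : D i1 j2 = 1) (h4 : D i0 j2 ≤ 0) :
    ∃ T : Fin m → Fin n → ℤ, (∀ i, ∑ j, T i j = 0) ∧ (∀ j, ∑ i, T i j = 0) ∧
      T i0 j1 = 1 ∧ T i1 j1 = -1 ∧ T i1 j2 = 1 ∧ T i0 j2 = -1 ∧
      (∀ i j, T i j = 0 ∨ (i = i0 ∧ j = j1) ∨ (i = i1 ∧ j = j1) ∨ (i = i1 ∧ j = j2) ∨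
        (i = i0 ∧ j = j2)) ∧
      ∑ i, ∑ j, (D i j - T i j) ^ 2 < ∑ i, ∑ j, (D i j) ^ 2 := by
  let u : Fin m → ℤ := fun i => (if i = i0 then 1 else 0) - (if i = i1 then 1 else 0)
  let v : Fin n → ℤ := fun j => (if j = j1 then 1 else 0) - (if j = j2 then 1 else 0)
  have hu : ∀ f : Fin m → ℤ, ∑ i, u i * f i = f i0 - f i1 := by
    intro f; simp [u, sub_mul, Finset.sum_sub_distrib]
  have hv : ∀ f : Fin n → ℤ, ∑ j, v j * f j = f j1 - f j2 := by
    intro f; simp [v, sub_mul, Finset.sum_sub_distrib]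
  have u0 : u i0 = 1 := by simp [u, hi]
  have u1 : u i1 = -1 := by simp [u, hi.symm]
  have v1 : v j1 = 1 := by simp [v, hj]
  have v2 : v j2 = -1 := by simp [v, hj.symm]
  refine ⟨fun i j => u i * v j, ?_, ?_, by simp [u0, v1], by simp [u1, v1], by simp [u1, v2],
    by simp [u0, v2], ?_, ?_⟩
  · intro i
    have := hv (fun _ => u i)
    simp only [sub_self] at this
    rw [← this]; exact Finset.sum_congr rfl fun j _ => mul_comm _ _
  · intro j
    have := hu (fun _ => v j)
    simpa using this
  · intro i j
    simp only [u, v]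
    by_cases a : i = i0 <;> by_cases b : i = i1 <;> by_cases c : j = j1 <;>
      by_cases d : j = j2 <;> simp_all
  · have key : ∑ i, ∑ j, (D i j - u i * v j) ^ 2 = ∑ i, ∑ j, (D i j) ^ 2
        + ∑ i, u i * ∑ j, v j * (u i * v j - 2 * D i j) := by
      rw [← Finset.sum_add_distrib]
      refine Finset.sum_congr rfl fun i _ => ?_
      rw [Finset.mul_sum, ← Finset.sum_add_distrib]
      refine Finset.sum_congr rfl fun j _ => ?_
      ring
    have h5 : ∑ i, u i * ∑ j, v j * (u i * v j - 2 * D i j) < 0 := by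
      rw [hu, hv, hv, u0, u1, v1, v2, h1, h2, h3]
      linarith
    simp only [key]
    linarith

theorem main_aux {m n : ℕ} (R : Fin m → ℤ) (S : Fin n → ℤ)
    (δ : Fin m → ℤ) (ε : Fin n → ℤ) (hδ : ∀ i, 0 ≤ δ i) (hε : ∀ j, 0 ≤ ε j)
    (i0 : Fin m) (hi0 : 0 < δ i0) (N : ℕ) :
    ∀ A A' : Fin m → Fin n → ℤ,
    (∀ i j, A i j = 0 ∨ A i j = 1) → (∀ i, ∑ j, A i j = R i) → (∀ j, ∑ i, A i j = S j) →
    (∀ i j, A' i j = 0 ∨ A' i j = 1) → (∀ i, ∑ j, A' i j = R i + δ i) →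
    (∀ j, ∑ i, A' i j = S j + ε j) →
    ∑ i, ∑ j, (A' i j - A i j) ^ 2 ≤ (N : ℤ) →
    ∃ j', 0 < ε j' ∧
      ∃ A : Fin m → Fin n → ℤ,
        (∀ i j, A i j = 0 ∨ A i j = 1) ∧
        (∀ i, ∑ j, A i j = R i) ∧
        (∀ j, ∑ i, A i j = S j) ∧
        A i0 j' = 0 := by
  induction N using Nat.strong_induction_on with
  | _ N ih =>
  intro A A' hA hAr hAc hB hBr hBc hN
  by_cases hmin : ∃ i1 j1 j2, A' i0 j1 - A i0 j1 = 1 ∧ A' i1 j1 - A i1 j1 = -1 ∧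
      A' i1 j2 - A i1 j2 = 1 ∧ A' i0 j2 - A i0 j2 ≤ 0
  · obtain ⟨i1, j1, j2, h1, h2, h3, h4⟩ := hmin
    have hi : i0 ≠ i1 := by rintro rfl; omega
    have hj : j1 ≠ j2 := by rintro rfl; omega
    obtain ⟨T, Tr, Tc, t1, t2, t3, t4, hT, hlt⟩ :=
      swap_aux (fun i j => A' i j - A i j) i0 i1 j1 j2 hi hj h1 h2 h3 h4
    have hnn : 0 ≤ ∑ i, ∑ j, (A' i j - A i j - T i j) ^ 2 :=
      Finset.sum_nonneg fun i _ => Finset.sum_nonneg fun j _ => sq_nonneg _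
    obtain ⟨M, hM⟩ := Int.eq_ofNat_of_zero_le hnn
    have hMN : M < N := by
      have : (M : ℤ) < N := by rw [← hM]; linarith
      exact_mod_cast this
    have a1 := hA i0 j1
    have a2 := hA i1 j1
    have a3 := hA i1 j2
    have b1 := hB i0 j1
    have b2 := hB i1 j1
    have b3 := hB i1 j2
    have b4 := hB i0 j2
    rcases hA i0 j2 with a4 | a4
    · refine ih M hMN A (fun i j => A' i j - T i j) hA hAr hAc ?_ ?_ ?_ ?_
      · intro i j
        have := hB i j
        rcases hT i j with h | ⟨rfl, rfl⟩ | ⟨rfl, rfl⟩ | ⟨rfl, rfl⟩ | ⟨rfl, rfl⟩ <;>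
          omega
      · intro i; rw [Finset.sum_sub_distrib, hBr, Tr, sub_zero]
      · intro i; rw [Finset.sum_sub_distrib, hBc, Tc, sub_zero]
      · rw [← hM]
        refine le_of_eq (Finset.sum_congr rfl fun i _ => Finset.sum_congr rfl fun j _ => ?_)
        ring
    · refine ih M hMN (fun i j => A i j + T i j) A' ?_ ?_ ?_ hB hBr hBc ?_
      · intro i j
        have := hA i j
        rcases hT i j with h | ⟨rfl, rfl⟩ | ⟨rfl, rfl⟩ | ⟨rfl, rfl⟩ | ⟨rfl, rfl⟩ <;>
          omega
      · intro i; rw [Finset.sum_add_distrib, hAr, Tr, add_zero]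
      · intro i; rw [Finset.sum_add_distrib, hAc, Tc, add_zero]
      · rw [← hM]
        refine le_of_eq (Finset.sum_congr rfl fun i _ => Finset.sum_congr rfl fun j _ => ?_)
        ring
  · by_contra hcon
    have hz : ∀ j, A' i0 j - A i0 j = 1 → ε j = 0 := by
      intro j hj
      by_contra hne
      have hp : 0 < ε j := lt_of_le_of_ne (hε j) (Ne.symm hne)
      refine hcon ⟨j, hp, A, hA, hAr, hAc, ?_⟩
      have := hA i0 j
      have := hB i0 j
      omega
    have hrow : ∀ i, ∑ j, (A' i j - A i j) = δ i := by
      intro i; rw [Finset.sum_sub_distrib, hAr, hBr]; ring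
    have hcol : ∀ j, ∑ i, (A' i j - A i j) = ε j := by
      intro i; rw [Finset.sum_sub_distrib, hAc, hBc]; ring
    let J := Finset.univ.filter fun j => A' i0 j - A i0 j = 1
    have hJ : ∀ j, j ∈ J ↔ A' i0 j - A i0 j = 1 := by intro j; simp [J]
    have hge : ∀ i, (∀ j, j ∉ J → A' i j - A i j ≤ 0) → δ i ≤ ∑ j ∈ J, (A' i j - A i j) := by
      intro i h
      rw [← hrow i, ← Finset.sum_add_sum_compl J]
      have : ∑ j ∈ Jᶜ, (A' i j - A i j) ≤ 0 :=
        Finset.sum_nonpos fun j hj => h j (Finset.mem_compl.mp hj)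
      linarith
    have htot : ∑ i, ∑ j ∈ J, (A' i j - A i j) = 0 := by
      rw [Finset.sum_comm]
      refine Finset.sum_eq_zero fun j hj => ?_
      rw [hcol, hz j ((hJ j).1 hj)]
    have hpos : 0 < ∑ i, ∑ j ∈ J, (A' i j - A i j) := by
      refine Finset.sum_pos' (fun i _ => ?_) ⟨i0, Finset.mem_univ _, ?_⟩
      · by_cases h : ∃ j1 ∈ J, A' i j1 - A i j1 = -1
        · obtain ⟨j1, hj1, h1⟩ := h
          refine le_trans (hδ i) (hge i fun j2 hj2 => ?_)
          by_contra hc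
          have := hA i j2
          have := hB i j2
          have := hA i0 j2
          have := hB i0 j2
          rw [hJ] at hj1 hj2
          exact hmin ⟨i, j1, j2, hj1, h1, by omega, by omega⟩
        · refine Finset.sum_nonneg fun j hj => ?_
          have := hA i j
          have := hB i j
          have : A' i j - A i j ≠ -1 := fun hh => h ⟨j, hj, hh⟩
          omega
      · refine lt_of_lt_of_le hi0 (hge i0 fun j hj => ?_)
        rw [hJ] at hj
        have := hA i0 j
        have := hB i0 j
        omega
    omega

/-- Let `R`, `S` be compatible integral vectors and let `δ`, `ε` be
integral vectors with `0 ≤ δᵢ ≤ n - rᵢ` and `0 ≤ εⱼ ≤ m - sⱼ`, such that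
`I₀ = {i | δᵢ > 0}` and `J₀ = {j | εⱼ > 0}` are nonempty. If both `𝔄(R,S)` and
`𝔄(R+δ, S+ε)` are nonempty, then there exist indices `i' ∈ I₀`, `j' ∈ J₀` and a binary
matrix `A ∈ 𝔄(R,S)` with `A i' j' = 0`. -/
theorem exists_zero_entry_of_augmented_class_nonempty
    (m n : ℕ) (R : Fin m → ℤ) (S : Fin n → ℤ)
    (hR : ∀ i, 0 ≤ R i ∧ R i ≤ (n : ℤ))
    (hS : ∀ j, 0 ≤ S j ∧ S j ≤ (m : ℤ))
    (hcomp : ∑ i, R i = ∑ j, S j)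
    (δ : Fin m → ℤ) (ε : Fin n → ℤ)
    (hδ : ∀ i, 0 ≤ δ i ∧ δ i ≤ (n : ℤ) - R i)
    (hε : ∀ j, 0 ≤ ε j ∧ ε j ≤ (m : ℤ) - S j)
    (hI0 : ∃ i, 0 < δ i) (hJ0 : ∃ j, 0 < ε j)
    (hA : ∃ A : Fin m → Fin n → ℤ,
        (∀ i j, A i j = 0 ∨ A i j = 1) ∧
        (∀ i, ∑ j, A i j = R i) ∧
        (∀ j, ∑ i, A i j = S j))
    (hA' : ∃ A : Fin m → Fin n → ℤ,
        (∀ i j, A i j = 0 ∨ A i j = 1) ∧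
        (∀ i, ∑ j, A i j = R i + δ i) ∧
        (∀ j, ∑ i, A i j = S j + ε j)) :
    ∃ i' j', 0 < δ i' ∧ 0 < ε j' ∧
      ∃ A : Fin m → Fin n → ℤ,
        (∀ i j, A i j = 0 ∨ A i j = 1) ∧
        (∀ i, ∑ j, A i j = R i) ∧
        (∀ j, ∑ i, A i j = S j) ∧
        A i' j' = 0 := by
  obtain ⟨i0, hi0⟩ := hI0
  obtain ⟨A, hA, hAr, hAc⟩ := hA
  obtain ⟨B, hB, hBr, hBc⟩ := hA'
  obtain ⟨j, hj, h⟩ := main_aux R S δ ε (fun i => (hδ i).1) (fun j => (hε j).1) i0 hi0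
    (∑ i, ∑ j, (B i j - A i j) ^ 2).toNat A B hA hAr hAc hB hBr hBc (Int.self_le_toNat _)
  exact ⟨i0, j, hi0, hj, h⟩
end
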